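/- arXiv:2311.05517 — 2 statements merged into one kernel-verified Lean document; each statement's English description precedes it below -/
import Mathlib

section
/- Let d ≥ 3 and t ≥ 2 be integers and let ε > 0. There exists a constant C = C(d, t, ε) with the following property. Let m₁, …, m_d : ℝ² → ℝ be arbitrary functions. Let A be a set of n nonzero vectors in ℝ^d, no two of which are scalar multiples of each other, and for a = (a₁, …, a_d) ∈ A set γ_a = { p ∈ ℝ² : a₁·m₁(p) + ⋯ + a_d·m_d(p) = 0 }. Let P be a set of m points in ℝ². Assume that there do not exist t distinct points of P and two distinct vectors a, a′ ∈ A such that all t points lie in γ_a ∩ γ_{a′}. Then the number of incidences Σ_{a ∈ A} |{ p ∈ P : p ∈ γ_a }| is at most C·( n^{(2d−4)/(2d−3)+ε} · m^{(d−1)/(2d−3)} + m + n ). -/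
/-- The sign vector of a point with respect to a family of linear forms. -/
noncomputable def signVec {V ι : Type*} [AddCommGroup V] [Module ℝ V]
    (φ : ι → Module.Dual ℝ V) (x : V) : ι → SignType :=
  fun i => SignType.sign (φ i x)

/-- `Conforms σ τ` says that `σ` arises from `τ` by replacing some entries by `0`. -/
def Conforms {ι : Type*} (σ τ : ι → SignType) : Prop :=
  ∀ i, σ i ≠ 0 → τ i = σ i

lemma Conforms.refl {ι : Type*} (σ : ι → SignType) : Conforms σ σ := fun _ _ => rfl

lemma Conforms.trans {ι : Type*} {σ τ ρ : ι → SignType} (h : Conforms σ τ) (h' : Conforms τ ρ) :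
    Conforms σ ρ := fun i hi => by
  have h1 := h i hi
  rw [h' i (by rwa [h1]), h1]

section SignVectors

variable {V ι : Type*} [AddCommGroup V] [Module ℝ V]

lemma signVec_apply (φ : ι → Module.Dual ℝ V) (x : V) (i : ι) :
    signVec φ x i = SignType.sign (φ i x) := rfl

lemma Conforms.eq_zero {φ : ι → Module.Dual ℝ V} {x y : V}
    (h : Conforms (signVec φ x) (signVec φ y)) {i : ι} (hi : φ i y = 0) : φ i x = 0 := by
  by_contra hx
  have := h i (by simpa [signVec_apply, sign_eq_zero_iff] using hx)
  simp only [signVec_apply, hi, sign_zero] at this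
  exact hx (sign_eq_zero_iff.1 this.symm)

lemma Conforms.mul_nonneg {φ : ι → Module.Dual ℝ V} {x y z : V}
    (hx : Conforms (signVec φ x) (signVec φ z)) (hy : Conforms (signVec φ y) (signVec φ z)) (i : ι) :
    0 ≤ φ i x * φ i y := by
  by_cases h1 : φ i x = 0
  · simp [h1]
  by_cases h2 : φ i y = 0
  · simp [h2]
  have e1 := hx i (by simpa [signVec_apply, sign_eq_zero_iff] using h1)
  have e2 := hy i (by simpa [signVec_apply, sign_eq_zero_iff] using h2)
  rw [e1, signVec_apply, signVec_apply] at e2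
  rcases lt_or_gt_of_ne h1 with h | h
  · rw [sign_neg h] at e2
    exact mul_nonneg_of_nonpos_of_nonpos h.le (sign_eq_neg_one_iff.1 e2.symm).le
  · rw [sign_pos h] at e2
    exact _root_.mul_nonneg h.le (sign_eq_one_iff.1 e2.symm).le

/-- Moving from `x` in the direction `-w` until leaving the open face of `x`. -/
lemma exists_push [Finite ι] (φ : ι → Module.Dual ℝ V) (x w : V)
    (h0 : ∀ i, φ i x = 0 → φ i w = 0) (hex : ∃ i, 0 < φ i w * φ i x) :
    ∃ τ : ℝ, 0 < τ ∧ Conforms (signVec φ (x - τ • w)) (signVec φ x) ∧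
      ∃ i, φ i x ≠ 0 ∧ φ i (x - τ • w) = 0 := by
  obtain ⟨i₀, hi₀⟩ := hex
  have : Nonempty ι := ⟨i₀⟩
  obtain ⟨i₁, hi₁⟩ := Finite.exists_max (fun i => φ i w / φ i x)
  have hpos : 0 < φ i₁ w / φ i₁ x := by
    refine lt_of_lt_of_le ?_ (hi₁ i₀)
    have hx : φ i₀ x ≠ 0 := by rintro h; simp [h] at hi₀
    rw [show φ i₀ w / φ i₀ x = (φ i₀ w * φ i₀ x) / (φ i₀ x) ^ 2 by field_simp]
    positivity
  set M := φ i₁ w / φ i₁ x with hM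
  have hx1 : φ i₁ x ≠ 0 := by rintro h; simp [h, hM] at hpos
  have key : ∀ i, φ i (x - M⁻¹ • w) = φ i x * (1 - M⁻¹ * (φ i w / φ i x)) := by
    intro i
    by_cases h : φ i x = 0
    · simp [h, h0 i h]
    · simp only [map_sub, map_smul, smul_eq_mul]
      field_simp
  refine ⟨M⁻¹, inv_pos.2 hpos, ?_, i₁, hx1, ?_⟩
  · intro i hi
    rw [signVec_apply, key, sign_mul] at hi
    rw [signVec_apply, signVec_apply, key, sign_mul]
    have h1 : 0 ≤ 1 - M⁻¹ * (φ i w / φ i x) := by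
      have := mul_le_mul_of_nonneg_left (hi₁ i) (inv_pos.2 hpos).le
      rw [inv_mul_cancel₀ hpos.ne'] at this
      linarith
    rcases h1.eq_or_lt with h1 | h1
    · rw [← h1] at hi
      simp at hi
    · rw [sign_pos h1, mul_one]
  · rw [key, ← hM, inv_mul_cancel₀ hpos.ne']; simp

lemma exists_signVec_extrapolate [Finite ι] (φ : ι → Module.Dual ℝ V) {x y : V}
    (h : signVec φ x = signVec φ y) :
    ∃ η : ℝ, 0 < η ∧ signVec φ (y + η • (y - x)) = signVec φ y := by
  have key : ∀ i, ∀ᶠ η : ℝ in nhdsWithin 0 (Set.Ioi 0),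
      SignType.sign (φ i (y + η • (y - x))) = SignType.sign (φ i y) := by
    intro i
    have hi : SignType.sign (φ i x) = SignType.sign (φ i y) := congrFun h i
    have hlim : Filter.Tendsto (fun η : ℝ => φ i (y + η • (y - x)))
        (nhdsWithin 0 (Set.Ioi 0)) (nhds (φ i y)) := by
      have : Continuous (fun η : ℝ => φ i (y + η • (y - x))) := by
        simp only [map_add, map_smul, smul_eq_mul]
        fun_prop
      have h2 := this.tendsto 0
      simp only [zero_smul, add_zero] at h2
      exact h2.mono_left nhdsWithin_le_nhds
    rcases lt_trichotomy (φ i y) 0 with hy | hy | hy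
    · filter_upwards [hlim.eventually_lt_const hy] with η hη
      rw [sign_neg hη, sign_neg hy]
    · have hx : φ i x = 0 := by rw [hy, sign_zero] at hi; exact sign_eq_zero_iff.1 hi
      filter_upwards with η
      simp [hx, hy]
    · filter_upwards [hlim.eventually_const_lt hy] with η hη
      rw [sign_pos hη, sign_pos hy]
  obtain ⟨η, h1, h2⟩ := ((Filter.eventually_all.2 key).and self_mem_nhdsWithin).exists
  exact ⟨η, h2, funext h1⟩

/-- If a linear form `h` takes two different signs on an open face, then every face having that face
in its closure meets the kernel of `h`. -/
lemma exists_mem_ker_of_sign_ne [Finite ι] (φ : ι → Module.Dual ℝ V) (W : Submodule ℝ V)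
    (h : Module.Dual ℝ V) {x y w : V} (hx : x ∈ W) (hy : y ∈ W) (hw : w ∈ W)
    (hxy : signVec φ x = signVec φ y) (hne : SignType.sign (h x) ≠ SignType.sign (h y))
    (hc : Conforms (signVec φ x) (signVec φ w)) :
    ∃ z ∈ W, signVec φ z = signVec φ w ∧ h z = 0 := by
  have extr : ∀ x y : V, x ∈ W → y ∈ W → signVec φ x = signVec φ y →
      SignType.sign (h x) ≠ SignType.sign (h y) → h x < h y →
      (∃ u ∈ W, signVec φ u = signVec φ x ∧ h u < 0) ∧
      (∃ u ∈ W, signVec φ u = signVec φ x ∧ 0 < h u) := by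
    intro x y hx hy hxy hne hlt
    have h1 : h x ≤ 0 := by
      by_contra hc
      push Not at hc
      exact hne (by rw [sign_pos hc, sign_pos (hc.trans hlt)])
    have h2 : 0 ≤ h y := by
      by_contra hc
      push Not at hc
      exact hne (by rw [sign_neg hc, sign_neg (hlt.trans hc)])
    obtain ⟨η, hη, e⟩ := exists_signVec_extrapolate φ hxy
    obtain ⟨θ, hθ, e'⟩ := exists_signVec_extrapolate φ hxy.symm
    refine ⟨⟨_, W.add_mem hx (W.smul_mem θ (W.sub_mem hx hy)), e', ?_⟩,
      ⟨_, W.add_mem hy (W.smul_mem η (W.sub_mem hy hx)), e.trans hxy.symm, ?_⟩⟩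
    · simp only [map_add, map_smul, map_sub, smul_eq_mul]
      nlinarith
    · simp only [map_add, map_smul, map_sub, smul_eq_mul]
      nlinarith
  have both : (∃ u ∈ W, signVec φ u = signVec φ x ∧ h u < 0) ∧
      (∃ u ∈ W, signVec φ u = signVec φ x ∧ 0 < h u) := by
    rcases lt_trichotomy (h x) (h y) with hlt | heq | hlt
    · exact extr x y hx hy hxy hne hlt
    · exact absurd (by rw [heq]) hne
    · rw [hxy]
      exact extr y x hy hx hxy.symm hne.symm hlt
  have move : ∀ u ∈ W, signVec φ u = signVec φ x → h u * h w < 0 →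
      ∃ z ∈ W, signVec φ z = signVec φ w ∧ h z = 0 := by
    intro u hu hux hneg
    have hu0 : h u ≠ 0 := by rintro h'; simp [h'] at hneg
    have hM : 0 < -(h w) / h u := by
      rw [show -(h w) / h u = -(h u * h w) / (h u) ^ 2 by field_simp]
      have := neg_pos.2 hneg
      positivity
    refine ⟨w + (-(h w) / h u) • u, W.add_mem hw (W.smul_mem _ hu), ?_, ?_⟩
    · funext i
      have hci := hc i
      rw [← hux] at hci
      simp only [signVec_apply, map_add, map_smul, smul_eq_mul] at hci ⊢
      rcases lt_trichotomy (φ i u) 0 with hi | hi | hi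
      · rw [sign_neg hi] at hci
        have hwi : φ i w < 0 := sign_eq_neg_one_iff.1 (hci (by decide))
        rw [sign_neg hwi, sign_neg]
        nlinarith
      · simp [hi]
      · rw [sign_pos hi] at hci
        have hwi : 0 < φ i w := sign_eq_one_iff.1 (hci (by decide))
        rw [sign_pos hwi, sign_pos]
        positivity
    · simp only [map_add, map_smul, smul_eq_mul]
      field_simp
      ring
  obtain ⟨⟨u, hu, hux, hun⟩, ⟨u', hu', hux', hup⟩⟩ := both
  rcases lt_trichotomy (h w) 0 with hlt | heq | hlt
  · exact move u' hu' hux' (mul_neg_of_pos_of_neg hup hlt)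
  · exact ⟨w, hw, rfl, heq⟩
  · exact move u hu hux (mul_neg_of_neg_of_pos hun hlt)

/-- Chains of length `k` of faces (given by sign vectors, in decreasing order) of a linear
hyperplane arrangement inside a subspace `W`. -/
def faceChains (k : ℕ) (φ : ι → Module.Dual ℝ V) (W : Submodule ℝ V) :
    Set (Fin k → ι → SignType) :=
  {c | (∃ x : Fin k → V, (∀ j, x j ∈ W) ∧ ∀ j, c j = signVec φ (x j)) ∧
    ∀ j j', j ≤ j' → Conforms (c j') (c j)}

lemma faceChains_last_eq {k s : ℕ} (φ : Fin (s + 1) → Module.Dual ℝ V) (W : Submodule ℝ V)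
    {c c' : Fin k → Fin (s + 1) → SignType} (hc : c ∈ faceChains k φ W)
    (hc' : c' ∈ faceChains k φ W)
    (heq : (fun j (i : Fin s) => c j i.castSucc) = fun j i => c' j i.castSucc)
    (hne : c ≠ c') :
    (fun j (i : Fin s) => c j i.castSucc) ∈
      faceChains k (fun i : Fin s => φ i.castSucc) (W ⊓ LinearMap.ker (φ (Fin.last s))) := by
  classical
  obtain ⟨⟨x, hxW, hx⟩, hmono⟩ := hc
  obtain ⟨⟨y, hyW, hy⟩, hmono'⟩ := hc'
  have hlast : ∃ j, c j (Fin.last s) ≠ c' j (Fin.last s) := by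
    by_contra hcon
    push Not at hcon
    refine hne (funext fun j => funext fun i => ?_)
    induction i using Fin.lastCases with
    | last => exact hcon j
    | cast i => exact congrFun (congrFun heq j) i
  set D := Finset.univ.filter fun j => c j (Fin.last s) ≠ c' j (Fin.last s) with hD
  have hDne : D.Nonempty := by
    obtain ⟨j, hj⟩ := hlast
    exact ⟨j, by simp [hD, hj]⟩
  set j₀ := D.max' hDne with hj₀
  have hj₀D : c j₀ (Fin.last s) ≠ c' j₀ (Fin.last s) := by
    have := D.max'_mem hDne
    exact (Finset.mem_filter.1 this).2
  have hz : ∀ j, ∃ z ∈ W, signVec (fun i : Fin s => φ i.castSucc) z =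
      signVec (fun i : Fin s => φ i.castSucc) (x j) ∧ φ (Fin.last s) z = 0 := by
    intro j
    rcases lt_or_ge j₀ j with hlt | hle
    · have hsame : c j (Fin.last s) = c' j (Fin.last s) := by
        by_contra hcon
        exact absurd (D.le_max' j (by simp [hD, hcon])) (not_le.2 hlt)
      have hzero : c j (Fin.last s) = 0 := by
        by_contra hcon
        apply hj₀D
        rw [hmono j₀ j hlt.le _ hcon, hmono' j₀ j hlt.le _ (by rwa [← hsame]), hsame]
      refine ⟨x j, hxW j, rfl, ?_⟩
      rw [hx, signVec_apply] at hzero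
      exact sign_eq_zero_iff.1 hzero
    · refine exists_mem_ker_of_sign_ne (fun i : Fin s => φ i.castSucc) W (φ (Fin.last s))
        (hxW j₀) (hyW j₀) (hxW j) ?_ ?_ ?_
      · funext i
        have := congrFun (congrFun heq j₀) i
        simp only [hx, hy] at this
        exact this
      · rw [hx, hy] at hj₀D
        exact hj₀D
      · intro i hi
        have := hmono j j₀ hle i.castSucc
        rw [hx, hx] at this
        exact this hi
  choose z hzW hzs hz0 using hz
  refine ⟨⟨z, fun j => ⟨hzW j, LinearMap.mem_ker.2 (hz0 j)⟩, fun j => ?_⟩,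
    fun j j' hjj i hi => hmono j j' hjj i.castSucc hi⟩
  rw [hzs]
  funext i
  simp only [hx]
  rfl

lemma ncard_faceChains_succ_le {k s : ℕ} (φ : Fin (s + 1) → Module.Dual ℝ V)
    (W : Submodule ℝ V) :
    (faceChains k φ W).ncard ≤ (faceChains k (fun i : Fin s => φ i.castSucc) W).ncard +
      3 ^ k * (faceChains k (fun i : Fin s => φ i.castSucc)
        (W ⊓ LinearMap.ker (φ (Fin.last s)))).ncard := by
  classical
  set X := faceChains k φ W
  set N := faceChains k (fun i : Fin s => φ i.castSucc) W
  set Y := faceChains k (fun i : Fin s => φ i.castSucc) (W ⊓ LinearMap.ker (φ (Fin.last s)))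
  set π : (Fin k → Fin (s + 1) → SignType) → (Fin k → Fin s → SignType) :=
    fun c j i => c j i.castSucc with hπ
  have hmaps : ∀ c ∈ X, π c ∈ N := by
    rintro c ⟨⟨x, hxW, hx⟩, hmono⟩
    refine ⟨⟨x, hxW, fun j => ?_⟩, fun j j' hjj i hi => hmono j j' hjj i.castSucc hi⟩
    funext i
    simp only [hπ, hx]
    rfl
  have h1 : (X \ π ⁻¹' Y).ncard ≤ N.ncard := by
    refine Set.ncard_le_ncard_of_injOn π (fun c hc => hmaps c hc.1) ?_ (Set.toFinite _)
    intro c hc c' hc' hcc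
    by_contra hne
    exact hc.2 (faceChains_last_eq φ W hc.1 hc'.1 hcc hne)
  have h2 : (X ∩ π ⁻¹' Y).ncard ≤ (Y ×ˢ (Set.univ : Set (Fin k → SignType))).ncard := by
    refine Set.ncard_le_ncard_of_injOn (fun c => (π c, fun j => c j (Fin.last s)))
      (fun c hc => ⟨hc.2, Set.mem_univ _⟩) ?_ (Set.toFinite _)
    intro c _ c' _ hcc
    simp only [Prod.mk.injEq] at hcc
    funext j i
    induction i using Fin.lastCases with
    | last => exact congrFun hcc.2 j
    | cast i => exact congrFun (congrFun hcc.1 j) i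
  have h3 : (Y ×ˢ (Set.univ : Set (Fin k → SignType))).ncard = 3 ^ k * Y.ncard := by
    rw [Set.ncard_prod, Set.ncard_univ, Nat.card_eq_fintype_card, Fintype.card_fun, mul_comm]
    simp [show Fintype.card SignType = 3 from rfl]
  have h4 := Set.ncard_inter_add_ncard_sdiff_eq_ncard X (π ⁻¹' Y) (Set.toFinite _)
  omega

variable [FiniteDimensional ℝ V]

lemma finrank_inf_ker_lt (W : Submodule ℝ V) (h : Module.Dual ℝ V) (hW : ∃ x ∈ W, h x ≠ 0) :
    Module.finrank ℝ (W ⊓ LinearMap.ker h : Submodule ℝ V) < Module.finrank ℝ W := by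
  obtain ⟨x, hx, hhx⟩ := hW
  refine Submodule.finrank_lt_finrank_of_lt (lt_of_le_of_ne inf_le_left fun he => hhx ?_)
  rw [← he] at hx
  exact LinearMap.mem_ker.1 hx.2

lemma ncard_faceChains_fin_le (k s δ : ℕ) (φ : Fin s → Module.Dual ℝ V) (W : Submodule ℝ V)
    (hW : Module.finrank ℝ W ≤ δ + 1) :
    (faceChains k φ W).ncard ≤ 3 ^ k * (1 + 3 ^ k * s) ^ δ := by
  classical
  induction s generalizing δ W with
  | zero =>
    have : (faceChains k φ W).ncard ≤ 1 := Set.ncard_le_one_of_subsingleton _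
    refine this.trans ?_
    simpa using Nat.one_le_pow k 3 (by norm_num)
  | succ s ih =>
    rcases δ with _ | δ
    · obtain ⟨w, hw⟩ := finrank_le_one_iff.1 hW
      have hsub : faceChains k φ W ⊆
          (Finset.univ.image fun (r : Fin k → SignType) j i =>
            r j * SignType.sign (φ i (w : V)) : Finset (Fin k → Fin (s + 1) → SignType)) := by
        rintro c ⟨⟨x, hxW, hx⟩, -⟩
        have hr : ∀ j, ∃ r : ℝ, r • (w : V) = x j := fun j => by
          obtain ⟨r, hr⟩ := hw ⟨x j, hxW j⟩
          exact ⟨r, by simpa using congrArg Subtype.val hr⟩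
        choose r hr using hr
        simp only [Finset.coe_image, Finset.coe_univ, Set.image_univ, Set.mem_range]
        refine ⟨fun j => SignType.sign (r j), funext fun j => funext fun i => ?_⟩
        rw [hx, signVec_apply, ← hr, map_smul, smul_eq_mul, sign_mul]
      have := Set.ncard_le_ncard hsub (Set.toFinite _)
      rw [Set.ncard_coe_finset] at this
      refine this.trans (Finset.card_image_le.trans ?_)
      simp [show Fintype.card SignType = 3 from rfl]
    · have hrec := ncard_faceChains_succ_le (k := k) φ W
      by_cases hker : ∃ x ∈ W, φ (Fin.last s) x ≠ 0
      · have hlt := finrank_inf_ker_lt W _ hker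
        have i1 := ih (δ + 1) (fun i => φ i.castSucc) W hW
        have i2 := ih δ (fun i => φ i.castSucc) (W ⊓ LinearMap.ker (φ (Fin.last s))) (by omega)
        have hmono : (1 + 3 ^ k * s) ^ δ ≤ (1 + 3 ^ k * (s + 1)) ^ δ := by gcongr; omega
        calc _ ≤ 3 ^ k * (1 + 3 ^ k * s) ^ (δ + 1) + 3 ^ k * (3 ^ k * (1 + 3 ^ k * s) ^ δ) :=
              hrec.trans (by gcongr)
          _ = 3 ^ k * ((1 + 3 ^ k * s) ^ δ * (1 + 3 ^ k * (s + 1))) := by ring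
          _ ≤ 3 ^ k * ((1 + 3 ^ k * (s + 1)) ^ δ * (1 + 3 ^ k * (s + 1))) := by gcongr
          _ = _ := by rw [pow_succ]
      · push Not at hker
        have h1 : (faceChains k φ W).ncard ≤
            (faceChains k (fun i : Fin s => φ i.castSucc) W).ncard := by
          refine Set.ncard_le_ncard_of_injOn (fun c j i => c j i.castSucc) ?_ ?_ (Set.toFinite _)
          · rintro c ⟨⟨x, hxW, hx⟩, hmono⟩
            refine ⟨⟨x, hxW, fun j => ?_⟩, fun j j' hjj i hi => hmono j j' hjj i.castSucc hi⟩
            funext i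
            simp only [hx]
            rfl
          · rintro c ⟨⟨x, hxW, hx⟩, -⟩ c' ⟨⟨x', hxW', hx'⟩, -⟩ hcc
            funext j i
            induction i using Fin.lastCases with
            | last => rw [hx, hx', signVec_apply, signVec_apply, hker _ (hxW j), hker _ (hxW' j)]
            | cast i => exact congrFun (congrFun hcc j) i
        refine h1.trans ((ih (δ + 1) _ W hW).trans ?_)
        gcongr
        omega

/-- The number of chains of faces of an arrangement of linear hyperplanes. -/
lemma ncard_faceChains_le [Fintype ι] (k δ : ℕ) (φ : ι → Module.Dual ℝ V) (W : Submodule ℝ V)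
    (hW : Module.finrank ℝ W ≤ δ + 1) :
    (faceChains k φ W).ncard ≤ 3 ^ k * (1 + 3 ^ k * Fintype.card ι) ^ δ := by
  classical
  refine le_trans ?_ (ncard_faceChains_fin_le k (Fintype.card ι) δ
    (fun i => φ ((Fintype.equivFin ι).symm i)) W hW)
  refine Set.ncard_le_ncard_of_injOn (fun c j i => c j ((Fintype.equivFin ι).symm i)) ?_ ?_
    (Set.toFinite _)
  · rintro c ⟨⟨x, hxW, hx⟩, hmono⟩
    refine ⟨⟨x, hxW, fun j => ?_⟩, fun j j' hjj i hi => hmono j j' hjj _ hi⟩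
    funext i
    simp only [hx]
    rfl
  · intro c _ c' _ hcc
    funext j i
    simpa using congrFun (congrFun hcc j) (Fintype.equivFin ι i)

end SignVectors

section Decomposition

variable {V ι : Type*} [AddCommGroup V] [Module ℝ V]

/-- A chosen nonzero vector in the common kernel of some linear forms (or `0` if there is none). -/
noncomputable def kernelVec {d : ℕ} (g : Fin d → Module.Dual ℝ V) : V :=
  open Classical in if h : ∃ v : V, v ≠ 0 ∧ ∀ j, g j v = 0 then h.choose else 0

/-- The vector described by `d` forms of the arrangement and a sign. -/
noncomputable def describedVec {d : ℕ} (φ : ι → Module.Dual ℝ V)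
    (δ : (Fin d → ι) × SignType) : V :=
  ((δ.2 : SignType) : ℝ) • kernelVec fun j => φ (δ.1 j)

lemma exists_extreme_vec [Finite ι] (φ : ι → Module.Dual ℝ V)
    (hφ : ∀ x, (∀ i, φ i x = 0) → x = 0) {x : V} (hx : x ≠ 0) :
    ∃ v, v ≠ 0 ∧ Conforms (signVec φ v) (signVec φ x) ∧
      ∀ w, (∀ i, φ i v = 0 → φ i w = 0) → ∃ c : ℝ, w = c • v := by
  induction hn : {i | φ i x ≠ 0}.ncard using Nat.strong_induction_on generalizing x with
  | _ n ih =>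
    by_cases hv : ∀ w, (∀ i, φ i x = 0 → φ i w = 0) → ∃ c : ℝ, w = c • x
    · exact ⟨x, hx, Conforms.refl _, hv⟩
    push Not at hv
    obtain ⟨w, hw, hwx⟩ := hv
    have hw0 : w ≠ 0 := fun h => hwx 0 (by simp [h])
    obtain ⟨i₀, hi₀⟩ : ∃ i, φ i w ≠ 0 := by
      by_contra hcon
      push Not at hcon
      exact hw0 (hφ w hcon)
    have hi₀x : φ i₀ x ≠ 0 := fun h => hi₀ (hw i₀ h)
    obtain ⟨w', hw', hwx', i₁, hi₁⟩ : ∃ w', (∀ i, φ i x = 0 → φ i w' = 0) ∧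
        (∀ c : ℝ, w' ≠ c • x) ∧ ∃ i, 0 < φ i w' * φ i x := by
      rcases lt_or_gt_of_ne (mul_ne_zero hi₀ hi₀x) with hlt | hlt
      · refine ⟨-w, fun i hi => by simp [hw i hi], fun c hc => hwx (-c) ?_, i₀, ?_⟩
        · rw [neg_smul, ← hc, neg_neg]
        · rw [map_neg]
          linarith
      · exact ⟨w, hw, hwx, i₀, hlt⟩
    obtain ⟨τ, hτ, hconf, i₂, hi₂, hi₂'⟩ := exists_push φ x w' hw' ⟨i₁, hi₁⟩
    have hx' : x - τ • w' ≠ 0 := fun h => hwx' τ⁻¹ (by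
      rw [sub_eq_zero.1 h, smul_smul, inv_mul_cancel₀ hτ.ne', one_smul])
    have hcard : {i | φ i (x - τ • w') ≠ 0}.ncard < n := by
      rw [← hn]
      refine Set.ncard_lt_ncard ⟨fun i hi h => hi (hconf.eq_zero h), fun hsub => ?_⟩
        (Set.toFinite _)
      exact hsub hi₂ hi₂'
    obtain ⟨v, hv, hvc, hvw⟩ := ih _ hcard hx' rfl
    exact ⟨v, hv, hvc.trans hconf, hvw⟩

/-- A form is *one-sided* on a tuple of vectors if it is weakly of one sign on them. -/
def OneSided {d : ℕ} (h : Module.Dual ℝ V) (v : Fin d → V) : Prop :=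
  (∀ j, 0 ≤ h (v j)) ∨ ∀ j, h (v j) ≤ 0

lemma OneSided.apply_sum_eq_zero_iff {d : ℕ} {h : Module.Dual ℝ V} {v : Fin d → V}
    (hv : OneSided h v) {c : Fin d → ℝ} (hc : ∀ j, 0 < c j) :
    h (∑ j, c j • v j) = 0 ↔ ∀ j, h (v j) = 0 := by
  simp only [map_sum, map_smul, smul_eq_mul]
  rcases hv with hv | hv
  · rw [Finset.sum_eq_zero_iff_of_nonneg fun j _ => mul_nonneg (hc j).le (hv j)]
    simp [(hc _).ne']
  · rw [Finset.sum_eq_zero_iff_of_nonpos fun j _ => mul_nonpos_of_nonneg_of_nonpos (hc j).le (hv j)]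
    simp [(hc _).ne']

variable [FiniteDimensional ℝ V]

lemma exists_forms_kernel_eq (k : ℕ) [Nonempty ι] (ψ : ι → Module.Dual ℝ V) (W : Submodule ℝ V)
    (hW : Module.finrank ℝ W ≤ k) :
    ∃ f : Fin k → ι, ∀ x ∈ W, (∀ j, ψ (f j) x = 0) → ∀ i, ψ i x = 0 := by
  induction k generalizing W with
  | zero =>
    have hbot : W = ⊥ := Submodule.finrank_eq_zero.1 (Nat.le_zero.1 hW)
    refine ⟨Fin.elim0, fun x hx _ i => ?_⟩
    rw [hbot, Submodule.mem_bot] at hx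
    simp [hx]
  | succ k ih =>
    by_cases h : ∃ i, ∃ x ∈ W, ψ i x ≠ 0
    · obtain ⟨i₀, hi₀⟩ := h
      have hlt := finrank_inf_ker_lt W (ψ i₀) hi₀
      obtain ⟨f, hf⟩ := ih (W ⊓ LinearMap.ker (ψ i₀)) (by omega)
      refine ⟨Fin.cons i₀ f, fun x hx hj => hf x ⟨hx, LinearMap.mem_ker.2 (hj 0)⟩ fun j => ?_⟩
      simpa using hj j.succ
    · push Not at h
      exact ⟨fun _ => Classical.arbitrary ι, fun x hx _ i => h i x hx⟩

lemma exists_describedVec [Finite ι] {d : ℕ} (hd : Module.finrank ℝ V ≤ d)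
    (φ : ι → Module.Dual ℝ V) (hφ : ∀ x, (∀ i, φ i x = 0) → x = 0) (hnull : ∃ i, φ i = 0)
    {x : V} (hx : x ≠ 0) :
    ∃ δ : (Fin d → ι) × SignType, describedVec φ δ ≠ 0 ∧
      Conforms (signVec φ (describedVec φ δ)) (signVec φ x) := by
  classical
  obtain ⟨v, hv, hconf, hker⟩ := exists_extreme_vec φ hφ hx
  obtain ⟨i₀, hi₀⟩ := hnull
  have : Nonempty ι := ⟨i₀⟩
  obtain ⟨f, hf⟩ := exists_forms_kernel_eq d (fun i => if φ i v = 0 then φ i else 0)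
    (⊤ : Submodule ℝ V) (by rwa [finrank_top])
  set g : Fin d → ι := fun j => if φ (f j) v = 0 then f j else i₀ with hg
  have hgf : ∀ j, φ (g j) = if φ (f j) v = 0 then φ (f j) else 0 := by
    intro j
    simp only [hg]
    split_ifs
    · rfl
    · exact hi₀
  have hex : ∃ u : V, u ≠ 0 ∧ ∀ j, φ (g j) u = 0 := by
    refine ⟨v, hv, fun j => ?_⟩
    rw [hgf]
    split_ifs with h
    · exact h
    · rfl
  have hu : kernelVec (fun j => φ (g j)) ≠ 0 ∧ ∀ j, φ (g j) (kernelVec fun j => φ (g j)) = 0 := by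
    rw [kernelVec, dif_pos hex]
    exact hex.choose_spec
  obtain ⟨c, hc⟩ := hker (kernelVec fun j => φ (g j)) (by
    intro i hi
    have := hf (kernelVec fun j => φ (g j)) trivial (fun j => by
      have := hu.2 j
      rwa [hgf] at this) i
    rwa [if_pos hi] at this)
  have hc0 : c ≠ 0 := fun h => hu.1 (by rw [hc, h, zero_smul])
  have hdes : describedVec φ (g, SignType.sign c) = |c| • v := by
    rw [describedVec]
    simp only
    rw [hc, smul_smul]
    congr 1
    exact sign_mul_self c
  refine ⟨(g, SignType.sign c), ?_, ?_⟩
  · rw [hdes]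
    exact smul_ne_zero (abs_ne_zero.2 hc0) hv
  · have : signVec φ (describedVec φ (g, SignType.sign c)) = signVec φ v := by
      funext i
      rw [hdes, signVec_apply, signVec_apply, map_smul, smul_eq_mul, sign_mul,
        sign_pos (abs_pos.2 hc0), one_mul]
    rwa [this]

/-- The linear span of the face of `x`. -/
def faceSpan (φ : ι → Module.Dual ℝ V) (x : V) : Submodule ℝ V where
  carrier := {y | ∀ i, φ i x = 0 → φ i y = 0}
  add_mem' := fun ha hb i hi => by rw [map_add, ha i hi, hb i hi, add_zero]
  zero_mem' := fun i _ => map_zero _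
  smul_mem' := fun c y hy i hi => by rw [map_smul, hy i hi, smul_zero]

lemma exists_chain_of_finrank_le [Finite ι] {d : ℕ} (φ : ι → Module.Dual ℝ V)
    (hφ : ∀ x, (∀ i, φ i x = 0) → x = 0) (desc : (ι → SignType) → (Fin d → ι) × SignType)
    (hdesc : ∀ x, x ≠ 0 → describedVec φ (desc (signVec φ x)) ≠ 0 ∧
      Conforms (signVec φ (describedVec φ (desc (signVec φ x)))) (signVec φ x))
    (hdesc0 : describedVec φ (desc (signVec φ 0)) = 0) (k : ℕ) (a : V)
    (ha : Module.finrank ℝ (faceSpan φ a) ≤ k) :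
    ∃ x : Fin k → V, (∀ j j', j ≤ j' → Conforms (signVec φ (x j')) (signVec φ (x j))) ∧
      (∀ j, Conforms (signVec φ (x j)) (signVec φ a)) ∧
      ∃ c : Fin k → ℝ, (∀ j, 0 < c j) ∧
        a = ∑ j, c j • describedVec φ (desc (signVec φ (x j))) := by
  induction k generalizing a with
  | zero =>
    have hbot : faceSpan φ a = ⊥ := Submodule.finrank_eq_zero.1 (Nat.le_zero.1 ha)
    have h : a ∈ faceSpan φ a := fun i hi => hi
    rw [hbot, Submodule.mem_bot] at h
    exact ⟨Fin.elim0, fun j => j.elim0, fun j => j.elim0, Fin.elim0, fun j => j.elim0, by simp [h]⟩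
  | succ k ih =>
    by_cases h0 : a = 0
    · subst h0
      exact ⟨fun _ => 0, fun _ _ _ => Conforms.refl _, fun _ => Conforms.refl _, fun _ => 1,
        fun _ => one_pos, by simp [hdesc0]⟩
    obtain ⟨hv0, hvc⟩ := hdesc a h0
    set v := describedVec φ (desc (signVec φ a)) with hv
    obtain ⟨i₀, hi₀⟩ : ∃ i, φ i v ≠ 0 := by
      by_contra hcon
      push Not at hcon
      exact hv0 (hφ v hcon)
    have hpos : 0 < φ i₀ v * φ i₀ a :=
      lt_of_le_of_ne (hvc.mul_nonneg (Conforms.refl _) i₀)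
        (mul_ne_zero hi₀ fun h => hi₀ (hvc.eq_zero h)).symm
    obtain ⟨τ, hτ, hconf, i₁, hi₁, hi₁'⟩ := exists_push φ a v (fun i => hvc.eq_zero) ⟨i₀, hpos⟩
    have hlt : Module.finrank ℝ (faceSpan φ (a - τ • v)) < Module.finrank ℝ (faceSpan φ a) := by
      refine Submodule.finrank_lt_finrank_of_lt
        ⟨fun y hy i hi => hy i (hconf.eq_zero hi), fun hle => hi₁ ?_⟩
      have : a ∈ faceSpan φ a := fun i hi => hi
      exact hle this i₁ hi₁'
    obtain ⟨x, hx, hxa, c, hc, hsum⟩ := ih (a - τ • v) (by omega)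
    refine ⟨Fin.cons a x, ?_, ?_, Fin.cons τ c, ?_, ?_⟩
    · intro j j' hjj
      induction j using Fin.cases with
      | zero =>
        induction j' using Fin.cases with
        | zero => exact Conforms.refl _
        | succ j' => simpa using (hxa j').trans hconf
      | succ j =>
        induction j' using Fin.cases with
        | zero => simp at hjj
        | succ j' => simpa using hx j j' (by simpa using hjj)
    · intro j
      induction j using Fin.cases with
      | zero => exact Conforms.refl _
      | succ j => simpa using (hxa j).trans hconf
    · intro j
      induction j using Fin.cases with
      | zero => simpa using hτ
      | succ j => simpa using hc j
    · rw [Fin.sum_univ_succ]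
      simp only [Fin.cons_zero, Fin.cons_succ]
      rw [← hsum, ← hv]
      abel

/-- The cells of an arrangement: space is divided into boundedly many open simplicial cones, each
spanned by vectors described by few forms, on which all forms of the arrangement are one-sided. -/
lemma exists_cells [Fintype ι] {d : ℕ} (hd : Module.finrank ℝ V = d)
    (φ : ι → Module.Dual ℝ V) (hφ : ∀ x, (∀ i, φ i x = 0) → x = 0) (hnull : ∃ i, φ i = 0) :
    ∃ (κ : V → Fin d → ι → SignType)
      (D : (Fin d → ι → SignType) → Fin d → (Fin d → ι) × SignType),
      (Set.range κ).ncard ≤ 3 ^ d * (1 + 3 ^ d * Fintype.card ι) ^ (d - 1) ∧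
      (∀ a, ∃ c : Fin d → ℝ, (∀ j, 0 < c j) ∧ a = ∑ j, c j • describedVec φ (D (κ a) j)) ∧
      ∀ a i, OneSided (φ i) fun j => describedVec φ (D (κ a) j) := by
  classical
  obtain ⟨i₀, hi₀⟩ := hnull
  have hex : ∀ σ : ι → SignType, ∃ δ : (Fin d → ι) × SignType,
      (∀ x, x ≠ 0 → signVec φ x = σ → describedVec φ δ ≠ 0 ∧
        Conforms (signVec φ (describedVec φ δ)) σ) ∧
      (σ = signVec φ 0 → describedVec φ δ = 0) := by
    intro σ
    by_cases h : ∃ x, x ≠ 0 ∧ signVec φ x = σ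
    · obtain ⟨x, hx, rfl⟩ := h
      obtain ⟨δ, hδ⟩ := exists_describedVec hd.le φ hφ ⟨i₀, hi₀⟩ hx
      refine ⟨δ, fun _ _ _ => hδ, fun h => absurd (hφ x fun i => ?_) hx⟩
      have := congrFun h i
      simpa [signVec_apply, sign_eq_zero_iff] using this
    · push Not at h
      exact ⟨(fun _ => i₀, 0), fun x hx hσ => absurd hσ (h x hx),
        fun _ => by simp [describedVec]⟩
  choose desc hdesc hdesc0 using hex
  have hchain := fun a => exists_chain_of_finrank_le φ hφ desc
    (fun x hx => hdesc _ x hx rfl) (hdesc0 _ rfl) d a (hd ▸ Submodule.finrank_le _)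
  choose x hmono hconf c hc hsum using hchain
  refine ⟨fun a j => signVec φ (x a j), fun σ j => desc (σ j), ?_, fun a => ⟨c a, hc a, hsum a⟩, ?_⟩
  · refine le_trans (Set.ncard_le_ncard ?_ (Set.toFinite _))
      (ncard_faceChains_le d (d - 1) φ ⊤ (by rw [finrank_top]; omega))
    rintro _ ⟨a, rfl⟩
    exact ⟨⟨x a, fun _ => trivial, fun _ => rfl⟩, hmono a⟩
  · intro a i
    have hcv : ∀ j, Conforms (signVec φ (describedVec φ (desc (signVec φ (x a j)))))
        (signVec φ a) := by
      intro j
      by_cases h : x a j = 0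
      · rw [h, hdesc0 _ rfl, ← h]
        exact hconf a j
      · exact (hdesc _ _ h rfl).2.trans (hconf a j)
    have hnn : ∀ j, 0 ≤ φ i (describedVec φ (desc (signVec φ (x a j)))) * φ i a :=
      fun j => (hcv j).mul_nonneg (Conforms.refl _) i
    rcases lt_trichotomy (φ i a) 0 with hlt | heq | hlt
    · exact Or.inr fun j => nonpos_of_mul_nonneg_left (hnn j) hlt
    · exact Or.inl fun j => ((hcv j).eq_zero heq).ge
    · exact Or.inl fun j => nonneg_of_mul_nonneg_left (hnn j) hlt

end Decomposition

section Sampling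

/-- Few samples `f` miss a large set `B f` that depends only on the values of `f` on `U`. -/
lemma card_samples_missing_le {s : ℕ} {P : Type*} [Fintype P] [DecidableEq P]
    (U : Finset (Fin s)) (B : (Fin s → P) → Finset P)
    (hB : ∀ f f' : Fin s → P, (∀ i ∈ U, f i = f' i) → B f = B f') {ε : ℝ} (hε1 : ε ≤ 1) :
    ((Finset.univ.filter fun f : Fin s → P =>
      (∀ i, f i ∉ B f) ∧ ε * Fintype.card P < (B f).card).card : ℝ) ≤
      (Fintype.card P : ℝ) ^ s * (1 - ε) ^ (s - U.card) := by
  classical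
  set X := Finset.univ.filter fun f : Fin s → P =>
      (∀ i, f i ∉ B f) ∧ ε * Fintype.card P < (B f).card with hX
  have hfib : ∀ g : U → P, ((X.filter fun f => (fun i : U => f i) = g).card : ℝ) ≤
      ((1 - ε) * Fintype.card P) ^ (s - U.card) := by
    intro g
    have hnn : (0 : ℝ) ≤ (1 - ε) * Fintype.card P := mul_nonneg (by linarith) (by positivity)
    rcases (X.filter fun f => (fun i : U => f i) = g).eq_empty_or_nonempty with he | ⟨f₀, hf₀⟩
    · rw [he, Finset.card_empty, Nat.cast_zero]
      exact pow_nonneg hnn _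
    rw [Finset.mem_filter, hX, Finset.mem_filter] at hf₀
    obtain ⟨⟨-, -, hlarge⟩, hg⟩ := hf₀
    have hsub : (X.filter fun f => (fun i : U => f i) = g) ⊆
        Fintype.piFinset fun i => if i ∈ U then {f₀ i} else (B f₀)ᶜ := by
      intro f hf
      rw [Finset.mem_filter, hX, Finset.mem_filter] at hf
      obtain ⟨⟨-, hmiss, -⟩, hfg⟩ := hf
      have hagree : ∀ i ∈ U, f i = f₀ i := fun i hi => congrFun (hfg.trans hg.symm) ⟨i, hi⟩
      rw [Fintype.mem_piFinset]
      intro i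
      split_ifs with hi
      · simp [hagree i hi]
      · rw [Finset.mem_compl, ← hB f f₀ hagree]
        exact hmiss i
    have hcard : (Fintype.piFinset fun i => if i ∈ U then {f₀ i} else (B f₀)ᶜ).card =
        (B f₀)ᶜ.card ^ (s - U.card) := by
      rw [Fintype.card_piFinset, ← Finset.prod_mul_prod_compl U]
      rw [Finset.prod_congr rfl (g := fun _ => 1) fun i hi => by simp [hi],
        Finset.prod_congr (s₁ := Uᶜ) rfl (g := fun _ => (B f₀)ᶜ.card) fun i hi => by
          rw [if_neg (Finset.mem_compl.1 hi)]]
      simp [Finset.card_compl]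
    have hle := Finset.card_le_card hsub
    rw [hcard] at hle
    calc ((X.filter fun f => (fun i : U => f i) = g).card : ℝ)
        ≤ ((B f₀)ᶜ.card : ℝ) ^ (s - U.card) := by exact_mod_cast hle
      _ ≤ _ := by
        refine pow_le_pow_left₀ (by positivity) ?_ _
        rw [Finset.card_compl, Nat.cast_sub (Finset.card_le_univ _)]
        linarith
  have hsum := Finset.card_eq_sum_card_fiberwise (s := X) (t := Finset.univ)
    (f := fun f (i : U) => f i) (fun _ _ => Finset.mem_coe.2 (Finset.mem_univ _))
  rw [hsum, Nat.cast_sum]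
  refine (Finset.sum_le_sum fun g _ => hfib g).trans ?_
  rw [Finset.sum_const, Finset.card_univ, Fintype.card_fun, Fintype.card_coe, nsmul_eq_mul,
    mul_pow, Nat.cast_pow]
  have hU : U.card ≤ s := by simpa using Finset.card_le_univ U
  have : (Fintype.card P : ℝ) ^ s = (Fintype.card P : ℝ) ^ U.card *
      (Fintype.card P : ℝ) ^ (s - U.card) := by rw [← pow_add]; congr 1; omega
  rw [this]
  exact le_of_eq (by ring)

/-- Random sampling: for some sample `f`, every set `B f δ` missed by `f` is small. -/
lemma exists_good_sample {s b : ℕ} {P Δ : Type*} [Fintype P] [Nonempty P] [DecidableEq P]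
    [Fintype Δ] (U : Δ → Finset (Fin s)) (hU : ∀ δ, (U δ).card ≤ b)
    (B : (Fin s → P) → Δ → Finset P)
    (hB : ∀ δ, ∀ f f' : Fin s → P, (∀ i ∈ U δ, f i = f' i) → B f δ = B f' δ)
    {ε : ℝ} (hε0 : 0 ≤ ε) (hε1 : ε ≤ 1) (hlt : Fintype.card Δ * (1 - ε) ^ (s - b) < 1) :
    ∃ f : Fin s → P, ∀ δ, (∀ i, f i ∉ B f δ) → ((B f δ).card : ℝ) ≤ ε * Fintype.card P := by
  classical
  by_contra hcon
  push Not at hcon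
  have hcover : (Finset.univ : Finset (Fin s → P)) ⊆ Finset.univ.biUnion fun δ =>
      Finset.univ.filter fun f : Fin s → P =>
        (∀ i, f i ∉ B f δ) ∧ ε * Fintype.card P < (B f δ).card := by
    intro f _
    obtain ⟨δ, h1, h2⟩ := hcon f
    simp only [Finset.mem_biUnion, Finset.mem_univ, true_and, Finset.mem_filter]
    exact ⟨δ, h1, h2⟩
  have h1 := (Finset.card_le_card hcover).trans Finset.card_biUnion_le
  rw [Finset.card_univ, Fintype.card_fun, Fintype.card_fin] at h1
  have h2 : (Fintype.card P : ℝ) ^ s ≤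
      ∑ _δ : Δ, (Fintype.card P : ℝ) ^ s * (1 - ε) ^ (s - b) := by
    have h1' := (Nat.cast_le (α := ℝ)).2 h1
    rw [Nat.cast_pow, Nat.cast_sum] at h1'
    refine h1'.trans (Finset.sum_le_sum fun δ _ => ?_)
    refine (card_samples_missing_le (U δ) (fun f => B f δ) (hB δ) hε1).trans ?_
    gcongr ?_ * ?_
    exact pow_le_pow_of_le_one (by linarith) (by linarith) (by have := hU δ; omega)
  rw [Finset.sum_const, Finset.card_univ, nsmul_eq_mul] at h2
  have hpos : (0 : ℝ) < (Fintype.card P : ℝ) ^ s := by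
    have := Fintype.card_pos (α := P)
    positivity
  nlinarith

end Sampling

section Cutting

variable {V : Type*} [AddCommGroup V] [Module ℝ V]

/-- A sample of forms, together with the coordinate forms and the zero form. -/
noncomputable def sampleForms {P : Type*} {s d : ℕ} (q : P → Module.Dual ℝ V)
    (e : Fin d → Module.Dual ℝ V) (f : Fin s → P) : Fin s ⊕ Option (Fin d) → Module.Dual ℝ V
  | Sum.inl i => q (f i)
  | Sum.inr (some j) => e j
  | Sum.inr none => 0

/-- The cutting lemma for linear forms: space is divided into few classes so that few forms have
both a zero and a nonzero on any given class. -/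
lemma exists_cutting [FiniteDimensional ℝ V] {P : Type*} [Fintype P] [Nonempty P] {d s : ℕ}
    (hd : Module.finrank ℝ V = d) (q : P → Module.Dual ℝ V) {ε : ℝ} (hε0 : 0 ≤ ε) (hε1 : ε ≤ 1)
    (hs : (((s + d + 1) ^ d * 3) ^ d : ℝ) * (1 - ε) ^ (s - d * d) < 1) :
    ∃ (κ : V → Fin d → Fin s ⊕ Option (Fin d) → SignType),
      (Set.range κ).ncard ≤ 3 ^ d * (1 + 3 ^ d * (s + d + 1)) ^ (d - 1) ∧
      ∀ σ, ({p | ∃ a a', κ a = σ ∧ κ a' = σ ∧ q p a = 0 ∧ q p a' ≠ 0}.ncard : ℝ) ≤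
        ε * Fintype.card P := by
  classical
  let bas := Module.finBasisOfFinrankEq ℝ V hd
  set e : Fin d → Module.Dual ℝ V := bas.coord with he
  let Δ := Fin d → (Fin d → Fin s ⊕ Option (Fin d)) × SignType
  let U : Δ → Finset (Fin s) := fun δ => Finset.univ.biUnion fun j =>
    Finset.univ.biUnion fun l => Sum.elim (fun i => {i}) (fun _ => ∅) ((δ j).1 l)
  have hU : ∀ δ, (U δ).card ≤ d * d := by
    intro δ
    refine (Finset.card_biUnion_le_card_mul _ _ d fun j _ => ?_).trans (by simp)
    refine (Finset.card_biUnion_le_card_mul _ _ 1 fun l _ => ?_).trans (by simp)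
    rcases (δ j).1 l with i | i <;> simp
  let B : (Fin s → P) → Δ → Finset P := fun f δ => Finset.univ.filter fun p =>
    ¬ OneSided (q p) fun j => describedVec (sampleForms q e f) (δ j)
  have hB : ∀ δ, ∀ f f' : Fin s → P, (∀ i ∈ U δ, f i = f' i) → B f δ = B f' δ := by
    intro δ f f' hff
    have : ∀ j, describedVec (sampleForms q e f) (δ j) =
        describedVec (sampleForms q e f') (δ j) := by
      intro j
      simp only [describedVec]
      congr 2
      funext l
      have hl : ∀ i, (δ j).1 l = Sum.inl i → f i = f' i := by
        intro i hi
        refine hff i ?_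
        simp only [U, Finset.mem_biUnion, Finset.mem_univ, true_and]
        exact ⟨j, l, by simp [hi]⟩
      rcases hδ : (δ j).1 l with i | (_ | i)
      · simp [sampleForms, hl i hδ]
      · rfl
      · rfl
    simp only [B, this]
  obtain ⟨f, hf⟩ := exists_good_sample U hU B hB hε0 hε1 (by
    refine lt_of_le_of_lt (le_of_eq ?_) hs
    congr 1
    simp only [Δ, Fintype.card_fun, Fintype.card_prod, Fintype.card_sum, Fintype.card_option,
      Fintype.card_fin, show Fintype.card SignType = 3 from rfl]
    push_cast
    ring)
  obtain ⟨κ, D, hκ, hsum, hone⟩ := exists_cells hd (sampleForms q e f) (fun x hx => by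
    refine bas.ext_elem fun j => ?_
    have := hx (Sum.inr (some j))
    simpa [sampleForms, he] using this) ⟨Sum.inr none, rfl⟩
  refine ⟨κ, hκ.trans (le_of_eq ?_), fun σ => ?_⟩
  · simp only [Fintype.card_sum, Fintype.card_option, Fintype.card_fin]
    ring
  · by_cases hσ : ∃ a, κ a = σ
    · obtain ⟨a₀, rfl⟩ := hσ
      refine le_trans ?_ (hf (D (κ a₀)) fun i => ?_)
      · rw [← Set.ncard_coe_finset, Nat.cast_le]
        refine Set.ncard_le_ncard ?_ (Set.toFinite _)
        rintro p ⟨a, a', ha, ha', hz, hnz⟩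
        simp only [B, Finset.coe_filter, Finset.mem_univ, true_and, Set.mem_ofPred_eq]
        intro hos
        obtain ⟨c, hc, hac⟩ := hsum a
        obtain ⟨c', hc', hac'⟩ := hsum a'
        rw [ha] at hac
        rw [ha'] at hac'
        apply hnz
        rw [hac', hos.apply_sum_eq_zero_iff hc', ← hos.apply_sum_eq_zero_iff hc, ← hac]
        exact hz
      · simp only [B, Finset.mem_filter, Finset.mem_univ, true_and, not_not]
        exact hone a₀ (Sum.inl i)
    · have : {p | ∃ a a', κ a = σ ∧ κ a' = σ ∧ q p a = 0 ∧ q p a' ≠ 0} = ∅ := by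
        ext p
        simp only [Set.mem_ofPred_eq, Set.mem_empty_iff_false, iff_false]
        rintro ⟨a, -, ha, -⟩
        exact hσ ⟨a, ha⟩
      rw [this, Set.ncard_empty, Nat.cast_zero]
      positivity

end Cutting

section Incidences

variable {V P : Type*} [AddCommGroup V] [Module ℝ V]

open Classical in
/-- The number of incidences between vectors in `A` and the kernels of the forms `q p`, `p ∈ Q`. -/
noncomputable def incidences (q : P → Module.Dual ℝ V) (A : Finset V) (Q : Finset P) : ℕ :=
  ((A ×ˢ Q).filter fun x => q x.2 x.1 = 0).card

open Classical in
/-- Any two distinct vectors of `A` lie on at most `t` common kernels. -/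
def FewCommon (t : ℕ) (q : P → Module.Dual ℝ V) (A : Finset V) (Q : Finset P) : Prop :=
  ∀ a ∈ A, ∀ a' ∈ A, a ≠ a' → (Q.filter fun p => q p a = 0 ∧ q p a' = 0).card ≤ t

lemma FewCommon.mono {t : ℕ} {q : P → Module.Dual ℝ V} {A A' : Finset V} {Q Q' : Finset P}
    (h : FewCommon t q A Q) (hA : A' ⊆ A) (hQ : Q' ⊆ Q) : FewCommon t q A' Q' := by
  classical
  intro a ha a' ha' hne
  exact (Finset.card_le_card (Finset.filter_subset_filter _ hQ)).trans
    (h a (hA ha) a' (hA ha') hne)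

open Classical in
lemma incidences_eq_sum_left (q : P → Module.Dual ℝ V) (A : Finset V) (Q : Finset P) :
    incidences q A Q = ∑ a ∈ A, (Q.filter fun p => q p a = 0).card := by
  rw [incidences, Finset.card_filter, Finset.sum_product]
  simp only [Finset.card_filter]

open Classical in
lemma incidences_eq_sum_right (q : P → Module.Dual ℝ V) (A : Finset V) (Q : Finset P) :
    incidences q A Q = ∑ p ∈ Q, (A.filter fun a => q p a = 0).card := by
  rw [incidences, Finset.card_filter, Finset.sum_product_right]
  simp only [Finset.card_filter]

lemma incidences_le_mul (q : P → Module.Dual ℝ V) (A : Finset V) (Q : Finset P) :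
    incidences q A Q ≤ A.card * Q.card := by
  classical
  rw [incidences, ← Finset.card_product]
  exact Finset.card_filter_le _ _

/-- The Kővári–Sós–Turán type bound, from counting pairs of vectors. -/
lemma incidences_le_sq {t : ℕ} {q : P → Module.Dual ℝ V} {A : Finset V} {Q : Finset P}
    (h : FewCommon t q A Q) : incidences q A Q ≤ Q.card + t * A.card ^ 2 := by
  classical
  have hdeg : ∀ p, (A.filter fun a => q p a = 0).card ≤
      1 + (A.offDiag.filter fun x => q p x.1 = 0 ∧ q p x.2 = 0).card := by
    intro p
    have hsub : (A.filter fun a => q p a = 0).offDiag ⊆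
        A.offDiag.filter fun x => q p x.1 = 0 ∧ q p x.2 = 0 := by
      intro x hx
      simp only [Finset.mem_offDiag, Finset.mem_filter] at hx ⊢
      tauto
    have h1 := Finset.card_le_card hsub
    rw [Finset.offDiag_card] at h1
    set k := (A.filter fun a => q p a = 0).card
    rcases Nat.lt_or_ge k 2 with hk | hk
    · omega
    · have : 2 * k ≤ k * k := Nat.mul_le_mul_right k hk
      omega
  rw [incidences_eq_sum_right]
  refine (Finset.sum_le_sum fun p _ => hdeg p).trans ?_
  rw [Finset.sum_add_distrib, Finset.sum_const, smul_eq_mul, mul_one]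
  gcongr
  simp only [Finset.card_filter]
  rw [Finset.sum_comm]
  simp only [← Finset.card_filter]
  refine (Finset.sum_le_card_nsmul _ _ t fun x hx => ?_).trans ?_
  · rw [Finset.mem_offDiag] at hx
    exact h x.1 hx.1 x.2 hx.2.1 hx.2.2
  · rw [smul_eq_mul, Finset.offDiag_card, mul_comm, sq]
    gcongr
    omega

/-- Passing to a class `A` of vectors, only the forms that vanish on a proper part of it matter. -/
lemma incidences_le_of_crossing {t : ℕ} {q : P → Module.Dual ℝ V} {A : Finset V}
    {Q X : Finset P} (h : FewCommon t q A Q)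
    (hX : ∀ p ∈ Q, ∀ a ∈ A, ∀ a' ∈ A, q p a = 0 → q p a' ≠ 0 → p ∈ X) :
    incidences q A Q ≤ incidences q A X + t * A.card + Q.card := by
  classical
  rcases Nat.lt_or_ge 1 A.card with hA | hA
  · refine le_trans ?_ (Nat.le_add_right _ _)
    rw [incidences_eq_sum_left, incidences_eq_sum_left, mul_comm, ← smul_eq_mul,
      ← Finset.sum_const, ← Finset.sum_add_distrib]
    refine Finset.sum_le_sum fun a ha => ?_
    obtain ⟨a', ha', hne⟩ := Finset.exists_mem_ne hA a
    refine le_trans ?_ (Nat.add_le_add_left (h a ha a' ha' hne.symm) _)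
    refine (Finset.card_le_card ?_).trans (Finset.card_union_le _ _)
    intro p hp
    rw [Finset.mem_filter] at hp
    rw [Finset.mem_union, Finset.mem_filter, Finset.mem_filter]
    by_cases h' : q p a' = 0
    · exact Or.inr ⟨hp.1, hp.2, h'⟩
    · exact Or.inl ⟨hX p hp.1 a ha a' ha' hp.2 h', hp.2⟩
  · have := incidences_le_mul q A Q
    have h2 := Nat.mul_le_mul_right Q.card hA
    omega

lemma incidences_le_sum_cells {L : Type*} [DecidableEq L] {t : ℕ} {q : P → Module.Dual ℝ V}
    {A : Finset V} {Q : Finset P} (h : FewCommon t q A Q) (l : V → L) (𝓛 : Finset L)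
    (hl : ∀ a ∈ A, l a ∈ 𝓛) (X : L → Finset P)
    (hX : ∀ p ∈ Q, ∀ a ∈ A, ∀ a' ∈ A, l a' = l a → q p a = 0 → q p a' ≠ 0 → p ∈ X (l a)) :
    incidences q A Q ≤ (∑ i ∈ 𝓛, incidences q (A.filter fun a => l a = i) (X i)) +
      t * A.card + 𝓛.card * Q.card := by
  classical
  have h1 : incidences q A Q = ∑ i ∈ 𝓛, incidences q (A.filter fun a => l a = i) Q := by
    simp only [incidences_eq_sum_left]
    exact (Finset.sum_fiberwise_of_maps_to hl _).symm
  have h2 : A.card = ∑ i ∈ 𝓛, (A.filter fun a => l a = i).card :=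
    Finset.card_eq_sum_card_fiberwise hl
  rw [h1, h2, Finset.mul_sum, ← smul_eq_mul (𝓛.card), ← Finset.sum_const,
    ← Finset.sum_add_distrib, ← Finset.sum_add_distrib]
  refine Finset.sum_le_sum fun i _ => incidences_le_of_crossing
    (h.mono (Finset.filter_subset _ _) (Finset.Subset.refl _)) ?_
  intro p hp a ha a' ha' hz hnz
  rw [Finset.mem_filter] at ha ha'
  have := hX p hp a ha.1 a' ha'.1 (ha'.2.trans ha.2.symm) hz hnz
  rwa [ha.2] at this

/-- A bound that is linear in the number of vectors when there are few forms, from the number of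
faces of the arrangement of all the forms. -/
lemma incidences_le_faces [FiniteDimensional ℝ V] {t d : ℕ} (hd : Module.finrank ℝ V = d + 2)
    {q : P → Module.Dual ℝ V} {A : Finset V} {Q : Finset P} (h : FewCommon t q A Q) :
    incidences q A Q ≤ 2 * t * A.card + Q.card + Q.card * (3 * (1 + 3 * Q.card) ^ d) := by
  classical
  set φ : Q → Module.Dual ℝ V := fun p => q p with hφ
  have h1 := incidences_le_of_crossing (X := Q.filter fun p => q p ≠ 0) h (by
    intro p hp a _ a' _ _ hnz
    rw [Finset.mem_filter]
    exact ⟨hp, fun h0 => hnz (by simp [h0])⟩)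
  set Q' := Q.filter fun p => q p ≠ 0 with hQ'
  set S := A.filter fun a => ∀ a' ∈ A, signVec φ a' = signVec φ a → a' = a with hS
  have h2 : incidences q A Q' ≤ incidences q S Q' + t * A.card := by
    rw [incidences_eq_sum_left, incidences_eq_sum_left, hS,
      ← Finset.sum_filter_add_sum_filter_not A
        (fun a => ∀ a' ∈ A, signVec φ a' = signVec φ a → a' = a)]
    gcongr
    refine (Finset.sum_le_card_nsmul _ _ t fun a ha => ?_).trans ?_
    · rw [Finset.mem_filter] at ha
      obtain ⟨ha, hns⟩ := ha
      push Not at hns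
      obtain ⟨a', ha', hs, hne⟩ := hns
      refine (Finset.card_le_card ?_).trans (h a ha a' ha' hne.symm)
      intro p hp
      rw [Finset.mem_filter, hQ', Finset.mem_filter] at hp
      rw [Finset.mem_filter]
      refine ⟨hp.1.1, hp.2, ?_⟩
      have := congrFun hs ⟨p, hp.1.1⟩
      simp only [signVec_apply, hφ, hp.2, sign_zero] at this
      exact sign_eq_zero_iff.1 this
    · rw [smul_eq_mul, mul_comm]
      gcongr
      exact Finset.filter_subset _ _
  have h3 : incidences q S Q' ≤ Q.card * (3 * (1 + 3 * Q.card) ^ d) := by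
    rw [incidences_eq_sum_right]
    refine (Finset.sum_le_card_nsmul _ _ (3 * (1 + 3 * Q.card) ^ d) fun p hp => ?_).trans ?_
    · rw [hQ', Finset.mem_filter] at hp
      have hlt := finrank_inf_ker_lt ⊤ (q p) (by
        by_contra hcon
        push Not at hcon
        exact hp.2 (LinearMap.ext fun x => hcon x trivial))
      rw [finrank_top] at hlt
      have hle := ncard_faceChains_le 1 d φ (⊤ ⊓ LinearMap.ker (q p)) (by omega)
      rw [pow_one, Fintype.card_coe] at hle
      refine le_trans ?_ hle
      rw [← Set.ncard_coe_finset]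
      refine Set.ncard_le_ncard_of_injOn (fun a _ => signVec φ a) ?_ ?_ (Set.toFinite _)
      · intro a ha
        simp only [Finset.coe_filter, Set.mem_ofPred_eq] at ha
        exact ⟨⟨fun _ => a, fun _ => ⟨trivial, LinearMap.mem_ker.2 ha.2⟩, fun _ => rfl⟩,
          fun _ _ _ => Conforms.refl _⟩
      · intro a ha a' ha' heq
        simp only [Finset.coe_filter, Set.mem_ofPred_eq, hS, Finset.mem_filter] at ha ha'
        exact ha'.1.2 a ha.1.1 (congrFun heq 0)
    · rw [smul_eq_mul]
      gcongr
      exact Finset.filter_subset _ _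
  calc _ ≤ _ := h1
    _ ≤ (Q.card * (3 * (1 + 3 * Q.card) ^ d) + t * A.card) + t * A.card + Q.card := by
      have := h2.trans (Nat.add_le_add_right h3 _)
      omega
    _ = _ := by ring

end Incidences

section Chunks

lemma exists_chunks {V : Type*} (X : Finset V) {N : ℕ} (hN : 0 < N) :
    ∃ g : V → ℕ, (∀ x ∈ X, g x < X.card / N + 1) ∧
      ∀ j, (X.filter fun x => g x = j).card ≤ N := by
  classical
  refine ⟨fun x => if h : x ∈ X then (X.equivFin ⟨x, h⟩).val / N else 0, ?_, ?_⟩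
  · intro x hx
    simp only [hx, dite_true]
    exact Nat.lt_succ_of_le (Nat.div_le_div_right (X.equivFin ⟨x, hx⟩).isLt.le)
  · intro j
    refine (Finset.card_le_card_of_injOn (t := Finset.Ico (j * N) (j * N + N))
      (fun x => if h : x ∈ X then (X.equivFin ⟨x, h⟩).val else 0) ?_ ?_).trans (by simp)
    · intro x hx
      simp only [Finset.coe_filter, Set.mem_ofPred_eq] at hx
      obtain ⟨hx, hj⟩ := hx
      simp only [hx, dite_true] at hj ⊢
      rw [Nat.div_eq_iff hN] at hj
      simp only [Finset.coe_Ico, Set.mem_Ico]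
      omega
    · intro x hx y hy hxy
      simp only [Finset.coe_filter, Set.mem_ofPred_eq] at hx hy
      simp only [hx.1, hy.1, dite_true] at hxy
      simpa using X.equivFin.injective (Fin.ext hxy)

lemma exists_refinement {V T : Type*} [DecidableEq T] (A : Finset V) (κ : V → T) (𝒦 : Finset T)
    (hκ : ∀ a ∈ A, κ a ∈ 𝒦) {N : ℕ} (hN : 0 < N) :
    ∃ (g : V → ℕ) (𝓛 : Finset (Σ _ : T, ℕ)), (∀ a ∈ A, ⟨κ a, g a⟩ ∈ 𝓛) ∧
      𝓛.card ≤ A.card / N + 𝒦.card ∧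
      ∀ i : Σ _ : T, ℕ, (A.filter fun a => (⟨κ a, g a⟩ : Σ _ : T, ℕ) = i).card ≤ N := by
  choose g hg hgN using fun c => exists_chunks (A.filter fun a => κ a = c) hN
  refine ⟨fun a => g (κ a) a,
    𝒦.sigma fun c => Finset.range ((A.filter fun a => κ a = c).card / N + 1), ?_, ?_, ?_⟩
  · intro a ha
    rw [Finset.mem_sigma]
    exact ⟨hκ a ha, Finset.mem_range.2 (hg _ a (by simp [ha]))⟩
  · rw [Finset.card_sigma]
    simp only [Finset.card_range]
    rw [Finset.sum_add_distrib, Finset.sum_const, smul_eq_mul, mul_one]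
    gcongr
    rw [Nat.le_div_iff_mul_le hN, Finset.sum_mul,
      Finset.card_eq_sum_card_fiberwise (s := A) (t := 𝒦) hκ]
    exact Finset.sum_le_sum fun c _ => Nat.div_mul_le_self _ _
  · rintro ⟨c, j⟩
    refine le_trans (Finset.card_le_card ?_) (hgN c j)
    intro a ha
    simp only [Finset.mem_filter, Sigma.mk.injEq, heq_eq_eq] at ha ⊢
    obtain ⟨ha, rfl, hj⟩ := ha
    exact ⟨⟨ha, rfl⟩, hj⟩

end Chunks

section Parameters

open Filter

lemma eventually_sample_size (d : ℕ) {η : ℝ} (hη : 0 < η) :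
    ∀ᶠ s : ℕ in atTop, (((s + d + 1) ^ d * 3) ^ d : ℝ) *
      (1 - (s : ℝ) ^ (η - 1)) ^ (s - d * d) < 1 ∨ 1 < (s : ℝ) ^ (η - 1) := by
  have hlim : Tendsto (fun x : ℝ => ((d + 2 : ℝ) ^ d * 3) ^ d *
      ((x ^ η) ^ ((d * d : ℕ) / η : ℝ) * Real.exp (-(1 / 2) * x ^ η))) atTop (nhds 0) := by
    have h := (tendsto_rpow_mul_exp_neg_mul_atTop_nhds_zero ((d * d : ℕ) / η : ℝ) (1 / 2)
      (by norm_num)).comp (tendsto_rpow_atTop hη)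
    simpa using h.const_mul (((d + 2 : ℝ) ^ d * 3) ^ d)
  have hlim' := hlim.comp tendsto_natCast_atTop_atTop (α := ℕ)
  filter_upwards [hlim'.eventually_lt_const one_pos, eventually_ge_atTop (2 * (d * d)),
    eventually_ge_atTop 1] with s hs hsd hs1
  rw [or_iff_not_imp_right, not_lt]
  intro hle
  refine lt_of_le_of_lt ?_ hs
  have hs1' : (1 : ℝ) ≤ s := by exact_mod_cast hs1
  have hs0 : (0 : ℝ) < s := by linarith
  simp only [Function.comp]
  rw [← mul_assoc]
  refine mul_le_mul ?_ ?_ (pow_nonneg (by linarith) _) (by positivity)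
  · rw [← Real.rpow_mul hs0.le, mul_div_cancel₀ _ hη.ne', Real.rpow_natCast, pow_mul, ← mul_pow]
    refine pow_le_pow_left₀ (by positivity) ?_ _
    have : (s + d + 1 : ℝ) ^ d ≤ ((d + 2 : ℝ) * s) ^ d := by
      refine pow_le_pow_left₀ (by positivity) ?_ _
      have : (0 : ℝ) ≤ d * (s - 1) := mul_nonneg (by positivity) (by linarith)
      nlinarith
    rw [mul_pow] at this
    nlinarith
  · refine (pow_le_pow_left₀ (by linarith) (Real.one_sub_le_exp_neg _) _).trans ?_
    rw [← Real.exp_nat_mul, Real.exp_le_exp]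
    have hN : (s : ℝ) / 2 ≤ (s - d * d : ℕ) := by
      rw [Nat.cast_sub (by omega)]
      have : (2 * (d * d) : ℝ) ≤ s := by exact_mod_cast hsd
      push_cast
      linarith
    have hsplit : (s : ℝ) ^ η = s * (s : ℝ) ^ (η - 1) := by
      rw [Real.rpow_sub_one hs0.ne']
      field_simp
    have hp : 0 < (s : ℝ) ^ (η - 1) := Real.rpow_pos_of_pos hs0 _
    rw [hsplit]
    nlinarith

lemma exists_parameters {d : ℕ} (hd : 3 ≤ d) {ε : ℝ} (hε : 0 < ε) :
    ∃ (s K : ℕ) (r : ℝ), 0 ≤ r ∧ r ≤ 1 ∧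
      (((s + d + 1) ^ d * 3) ^ d : ℝ) * (1 - r) ^ (s - d * d) < 1 ∧
      3 ^ d * (1 + 3 ^ d * (s + d + 1)) ^ (d - 1) ≤ K ∧ 3 ≤ K ∧
      2 * (K : ℝ) * ((2 / K : ℝ) ^ ((2 * (d : ℝ) - 4) / (2 * (d : ℝ) - 3) + ε) *
        r ^ (((d : ℝ) - 1) / (2 * (d : ℝ) - 3))) ≤ 1 / 2 := by
  have hd' : (3 : ℝ) ≤ d := by exact_mod_cast hd
  set α : ℝ := (2 * (d : ℝ) - 4) / (2 * (d : ℝ) - 3) with hα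
  set β : ℝ := ((d : ℝ) - 1) / (2 * (d : ℝ) - 3) with hβ
  have hden : (0 : ℝ) < 2 * (d : ℝ) - 3 := by linarith
  have hβ1 : β ≤ 1 := by rw [hβ, div_le_one hden]; linarith
  have hαβ : ((d : ℝ) - 1) * (1 - α) = β := by
    have h1 : 1 - (2 * (d : ℝ) - 4) / (2 * (d : ℝ) - 3) = 1 / (2 * (d : ℝ) - 3) := by
      rw [eq_div_iff hden.ne', sub_mul, div_mul_cancel₀ _ hden.ne']
      ring
    rw [hα, hβ, h1, mul_one_div]
  set η : ℝ := min ε 1 with hη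
  have hη0 : 0 < η := lt_min hε one_pos
  have hη1 : η ≤ 1 := min_le_right _ _
  have hηε : η ≤ ε := min_le_left _ _
  set γ := α + ε with hγ
  set θ : ℝ := -(((d : ℝ) - 1) * (1 - γ) + (η - 1) * β) with hθ
  have hθ0 : 0 < θ := by
    have : θ = ((d : ℝ) - 1) * ε - η * β := by
      rw [hθ, hγ]
      linear_combination (-1 : ℝ) * hαβ
    rw [this]
    have h1 : η * β ≤ η := by nlinarith
    nlinarith
  set c : ℕ := 3 ^ d * (1 + 3 ^ d * (d + 2)) ^ (d - 1) with hc
  have hc3 : 3 ≤ c := by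
    have h1 : 3 ^ 1 ≤ 3 ^ d := Nat.pow_le_pow_right (by norm_num) (by omega)
    have h2 : 1 ≤ (1 + 3 ^ d * (d + 2)) ^ (d - 1) := Nat.one_le_pow _ _ (by positivity)
    calc 3 = 3 ^ 1 * 1 := by norm_num
      _ ≤ c := Nat.mul_le_mul h1 h2
  have hlim : Tendsto (fun x : ℝ => 2 * (2 : ℝ) ^ γ * (c : ℝ) ^ (1 - γ) * x ^ (-θ)) atTop
      (nhds 0) := by
    simpa using (tendsto_rpow_neg_atTop hθ0).const_mul (2 * (2 : ℝ) ^ γ * (c : ℝ) ^ (1 - γ))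
  have hlim' := hlim.comp tendsto_natCast_atTop_atTop (α := ℕ)
  obtain ⟨s, hs, hsz, hs1⟩ := ((hlim'.eventually_le_const (show (0 : ℝ) < 1 / 2 by norm_num)).and
    ((eventually_sample_size d hη0).and (eventually_ge_atTop 1))).exists
  have hs1' : (1 : ℝ) ≤ s := by exact_mod_cast hs1
  have hs0 : (0 : ℝ) < s := by linarith
  have hr1 : (s : ℝ) ^ (η - 1) ≤ 1 := Real.rpow_le_one_of_one_le_of_nonpos hs1' (by linarith)
  refine ⟨s, c * s ^ (d - 1), (s : ℝ) ^ (η - 1), (Real.rpow_pos_of_pos hs0 _).le, hr1,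
    hsz.resolve_right (not_lt.2 hr1), ?_, ?_, ?_⟩
  · rw [hc, mul_assoc, ← mul_pow]
    gcongr
    have h1 : d + 1 ≤ (d + 1) * s := Nat.le_mul_of_pos_right _ hs1
    calc 1 + 3 ^ d * (s + d + 1) ≤ s + 3 ^ d * ((d + 2) * s) := by
          gcongr
          linarith
      _ = _ := by ring
  · exact hc3.trans (Nat.le_mul_of_pos_right _ (by positivity))
  · have hc0 : (0 : ℝ) < c := by exact_mod_cast (by omega : 0 < c)
    have hK0 : (0 : ℝ) < (c : ℝ) * (s : ℝ) ^ (d - 1) := by positivity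
    have hKs : ((c : ℝ) * (s : ℝ) ^ (d - 1)) ^ (1 - γ) =
        (c : ℝ) ^ (1 - γ) * (s : ℝ) ^ (((d : ℝ) - 1) * (1 - γ)) := by
      rw [Real.mul_rpow hc0.le (by positivity), ← Real.rpow_natCast, ← Real.rpow_mul hs0.le,
        Nat.cast_sub (by omega), Nat.cast_one]
    refine le_trans (le_of_eq ?_) hs
    simp only [Function.comp]
    push_cast
    rw [Real.div_rpow (by norm_num) hK0.le, ← Real.rpow_mul hs0.le]
    calc 2 * ((c : ℝ) * (s : ℝ) ^ (d - 1)) * (2 ^ γ / ((c : ℝ) * (s : ℝ) ^ (d - 1)) ^ γ *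
          (s : ℝ) ^ ((η - 1) * β))
        = 2 * 2 ^ γ * (((c : ℝ) * (s : ℝ) ^ (d - 1)) ^ (1 - γ)) * (s : ℝ) ^ ((η - 1) * β) := by
          rw [Real.rpow_sub hK0, Real.rpow_one]
          ring
      _ = 2 * 2 ^ γ * (c : ℝ) ^ (1 - γ) * (s : ℝ) ^ (-θ) := by
          rw [hKs, hθ, neg_neg, Real.rpow_add hs0]
          ring

end Parameters

section MainBound

variable {V P : Type*} [AddCommGroup V] [Module ℝ V] [FiniteDimensional ℝ V]

/-- One cutting step: the incidences split into few subproblems with few vectors and few forms. -/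
lemma incidences_le_sum_cutting {d s K t : ℕ} {r : ℝ} (hd : Module.finrank ℝ V = d)
    (hr0 : 0 ≤ r) (hr1 : r ≤ 1)
    (hs : (((s + d + 1) ^ d * 3) ^ d : ℝ) * (1 - r) ^ (s - d * d) < 1)
    (hK : 3 ^ d * (1 + 3 ^ d * (s + d + 1)) ^ (d - 1) ≤ K) (hK0 : 0 < K)
    {q : P → Module.Dual ℝ V} {A : Finset V} {Q : Finset P} (h : FewCommon t q A Q)
    (hQ : Q.Nonempty) (hA : K ≤ A.card) :
    ∃ (L : Type) (𝓛 : Finset L) (A' : L → Finset V) (Q' : L → Finset P),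
      𝓛.card ≤ 2 * K ∧ (∀ i, A' i ⊆ A) ∧ (∀ i, Q' i ⊆ Q) ∧
      (∀ i, ((A' i).card : ℝ) ≤ 2 / K * A.card) ∧ (∀ i, ((Q' i).card : ℝ) ≤ r * Q.card) ∧
      ∑ i ∈ 𝓛, (A' i).card = A.card ∧
      incidences q A Q ≤ (∑ i ∈ 𝓛, incidences q (A' i) (Q' i)) + t * A.card +
        𝓛.card * Q.card := by
  classical
  have : Nonempty Q := hQ.to_subtype
  obtain ⟨κ, hκ, hcross⟩ := exists_cutting hd (fun p : Q => q p) hr0 hr1 hs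
  have hKR : (0 : ℝ) < K := by exact_mod_cast hK0
  have hAK : (K : ℝ) ≤ A.card := by exact_mod_cast hA
  set N := ⌈(A.card : ℝ) / K⌉₊ with hN
  have hN0 : 0 < N := Nat.ceil_pos.2 (div_pos (by linarith) hKR)
  have hNle : (A.card : ℝ) / K ≤ N := Nat.le_ceil _
  have hNlt : (N : ℝ) < A.card / K + 1 := Nat.ceil_lt_add_one (by positivity)
  have hN2 : (N : ℝ) ≤ 2 / K * A.card := by
    have : 1 ≤ (A.card : ℝ) / K := by rwa [one_le_div hKR]
    calc (N : ℝ) ≤ A.card / K + A.card / K := by linarith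
      _ = 2 / K * A.card := by ring
  have hdiv : A.card / N ≤ K := by
    refine Nat.div_le_of_le_mul ?_
    rw [div_le_iff₀ hKR] at hNle
    exact_mod_cast hNle
  obtain ⟨g, 𝓛, h𝓛, hcard, hsmall⟩ := exists_refinement A κ (Set.range κ).toFinset
    (fun a _ => by simp) hN0
  have hrange : (Set.range κ).toFinset.card ≤ K := by
    rw [← Set.ncard_eq_toFinset_card']
    exact hκ.trans hK
  set X : (Σ _ : Fin d → Fin s ⊕ Option (Fin d) → SignType, ℕ) → Finset P := fun i =>
    Q.filter fun p => ∃ a a', κ a = i.1 ∧ κ a' = i.1 ∧ q p a = 0 ∧ q p a' ≠ 0 with hX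
  refine ⟨_, 𝓛, fun i => A.filter fun a => (⟨κ a, g a⟩ : Σ _, ℕ) = i, X, by omega,
    fun i => Finset.filter_subset _ _, fun i => Finset.filter_subset _ _,
    fun i => le_trans (by exact_mod_cast hsmall i) hN2, fun i => ?_,
    (Finset.card_eq_sum_card_fiberwise h𝓛).symm,
    incidences_le_sum_cells h (fun a => (⟨κ a, g a⟩ : Σ _, ℕ)) 𝓛 h𝓛 X ?_⟩
  · have := hcross i.1
    rw [Fintype.card_coe] at this
    refine le_trans ?_ this
    rw [Nat.cast_le, ← Set.ncard_coe_finset, ← Set.ncard_image_of_injective _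
      (Subtype.val_injective (p := fun p => p ∈ Q))]
    refine Set.ncard_le_ncard ?_ (Set.toFinite _)
    intro p hp
    simp only [hX, Finset.coe_filter, Set.mem_ofPred_eq] at hp
    exact ⟨⟨p, hp.1⟩, hp.2, rfl⟩
  · intro p hp a ha a' ha' hl hz hnz
    simp only [Sigma.mk.injEq, heq_eq_eq] at hl
    rw [hX, Finset.mem_filter]
    exact ⟨hp, a, a', rfl, hl.1, hz, hnz⟩

/-- The sum of the recursive bounds is absorbed by the main term. -/
lemma absorb_lower_order {C C₀ t K k a m X μ : ℝ} (hC0 : 0 ≤ C) (hC₀ : 0 ≤ C₀) (ht : 0 ≤ t)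
    (hK : 0 ≤ K) (hk : k ≤ 2 * K) (hm : 0 ≤ m) (hmX : m ≤ X) (haX : a ≤ X)
    (hμ0 : 0 ≤ μ) (hμ : 2 * K * μ ≤ 1 / 2) (hC : C = 2 * (C₀ + t + 2 * K * C₀ + 2 * K)) :
    k * (C * (μ * X)) + C₀ * (a + k * m) + t * a + k * m ≤ C * X := by
  have hX : 0 ≤ X := hm.trans hmX
  have hkm : k * m ≤ 2 * K * X := mul_le_mul hk hmX hm (by linarith)
  calc k * (C * (μ * X)) + C₀ * (a + k * m) + t * a + k * m
      ≤ 2 * K * (C * (μ * X)) + C₀ * (X + 2 * K * X) + t * X + 2 * K * X := by gcongr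
    _ = C * X * (2 * K * μ) + (C₀ + t + 2 * K * C₀ + 2 * K) * X := by ring
    _ ≤ C * X * (1 / 2) + (C₀ + t + 2 * K * C₀ + 2 * K) * X := by gcongr
    _ = C * X := by rw [hC]; ring

/-- In the balanced range, the main term of the incidence bound dominates both sizes. -/
lemma le_main_term {d : ℕ} (hd : 3 ≤ d) {ε a m : ℝ} (hε : 0 ≤ ε) (ha : 1 ≤ a) (hm : 1 ≤ m)
    (ham : a ≤ m ^ (d - 1)) (hma : m ≤ a ^ 2) :
    a ≤ a ^ ((2 * (d : ℝ) - 4) / (2 * (d : ℝ) - 3) + ε) *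
        m ^ (((d : ℝ) - 1) / (2 * (d : ℝ) - 3)) ∧
      m ≤ a ^ ((2 * (d : ℝ) - 4) / (2 * (d : ℝ) - 3) + ε) *
        m ^ (((d : ℝ) - 1) / (2 * (d : ℝ) - 3)) := by
  have hd' : (3 : ℝ) ≤ d := by exact_mod_cast hd
  have hden : (0 : ℝ) < 2 * (d : ℝ) - 3 := by linarith
  have ha0 : 0 < a := by linarith
  have hm0 : 0 < m := by linarith
  set α : ℝ := (2 * (d : ℝ) - 4) / (2 * (d : ℝ) - 3) with hα
  set β : ℝ := ((d : ℝ) - 1) / (2 * (d : ℝ) - 3) with hβ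
  have hαε : a ^ α ≤ a ^ (α + ε) := Real.rpow_le_rpow_of_exponent_le ha (by linarith)
  rw [← Real.rpow_natCast, Nat.cast_sub (by omega), Nat.cast_one] at ham
  rw [← Real.rpow_natCast, Nat.cast_ofNat] at hma
  constructor
  · have h2 := Real.rpow_le_rpow ha0.le ham (show 0 ≤ 1 / (2 * (d : ℝ) - 3) by positivity)
    rw [← Real.rpow_mul hm0.le, mul_one_div, ← hβ] at h2
    calc a = a ^ α * a ^ (1 / (2 * (d : ℝ) - 3)) := by
          rw [← Real.rpow_add ha0, hα, ← add_div,
            show 2 * (d : ℝ) - 4 + 1 = 2 * d - 3 by ring, div_self hden.ne', Real.rpow_one]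
      _ ≤ a ^ (α + ε) * m ^ β := mul_le_mul hαε h2 (by positivity) (by positivity)
  · have h2 := Real.rpow_le_rpow hm0.le hma
      (show 0 ≤ ((d : ℝ) - 2) / (2 * (d : ℝ) - 3) from div_nonneg (by linarith) hden.le)
    rw [← Real.rpow_mul ha0.le,
      show 2 * (((d : ℝ) - 2) / (2 * (d : ℝ) - 3)) = α by rw [hα]; ring] at h2
    calc m = m ^ (((d : ℝ) - 2) / (2 * (d : ℝ) - 3)) * m ^ β := by
          rw [← Real.rpow_add hm0, hβ, ← add_div,
            show (d : ℝ) - 2 + (d - 1) = 2 * d - 3 by ring, div_self hden.ne', Real.rpow_one]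
      _ ≤ a ^ (α + ε) * m ^ β := mul_le_mul_of_nonneg_right (h2.trans hαε) (by positivity)

/-- The incidence bound for vectors and kernels of linear forms without large `K_{t,2}`. -/
theorem exists_incidences_bound {d : ℕ} (hd3 : 3 ≤ d) (hd : Module.finrank ℝ V = d) (t : ℕ)
    {ε : ℝ} (hε : 0 < ε) :
    ∃ C : ℝ, 0 < C ∧ ∀ (q : P → Module.Dual ℝ V) (A : Finset V) (Q : Finset P),
      FewCommon t q A Q → (incidences q A Q : ℝ) ≤
        C * ((A.card : ℝ) ^ ((2 * (d : ℝ) - 4) / (2 * (d : ℝ) - 3) + ε) *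
          (Q.card : ℝ) ^ (((d : ℝ) - 1) / (2 * (d : ℝ) - 3)) + Q.card + A.card) := by
  obtain ⟨s, K, r, hr0, hr1, hs, hK, hK3, hcontr⟩ := exists_parameters hd3 hε
  have hd' : (3 : ℝ) ≤ d := by exact_mod_cast hd3
  set α : ℝ := (2 * (d : ℝ) - 4) / (2 * (d : ℝ) - 3) with hα
  set β : ℝ := ((d : ℝ) - 1) / (2 * (d : ℝ) - 3) with hβ
  have hden : (0 : ℝ) < 2 * (d : ℝ) - 3 := by linarith
  have hα0 : 0 ≤ α := div_nonneg (by linarith) hden.le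
  have hβ0 : 0 ≤ β := div_nonneg (by linarith) hden.le
  have hK3' : (3 : ℝ) ≤ K := by exact_mod_cast hK3
  set C₀ : ℝ := 2 * t + 3 * 4 ^ (d - 2) + 1 with hC₀
  have hC₀1 : 1 ≤ C₀ := by rw [hC₀]; linarith [show (0 : ℝ) ≤ 2 * t + 3 * 4 ^ (d - 2) by positivity]
  set C : ℝ := 2 * (C₀ + t + 2 * K * C₀ + 2 * K) with hC
  have hCK : (K : ℝ) ≤ C := by
    have : 0 ≤ (K : ℝ) * C₀ := by positivity
    have : (0 : ℝ) ≤ t := by positivity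
    rw [hC]; linarith
  have hC0 : 0 < C := by linarith
  have main : ∀ (n : ℕ) (q : P → Module.Dual ℝ V) (A : Finset V) (Q : Finset P), A.card = n →
      FewCommon t q A Q → (incidences q A Q : ℝ) ≤
        C * ((A.card : ℝ) ^ (α + ε) * (Q.card : ℝ) ^ β) + C₀ * (A.card + Q.card) := by
    intro n
    induction n using Nat.strong_induction_on with
    | _ n ih =>
    intro q A Q hn hfew
    have hXnn : 0 ≤ (A.card : ℝ) ^ (α + ε) * (Q.card : ℝ) ^ β := by positivity
    by_cases hcase1 : Q.card ^ (d - 1) ≤ A.card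
    · have h1 := incidences_le_faces (d := d - 2) (by omega) hfew
      have h2 : Q.card * (3 * (1 + 3 * Q.card) ^ (d - 2)) ≤ 3 * 4 ^ (d - 2) * A.card := by
        rcases Nat.eq_zero_or_pos Q.card with h0 | h0
        · simp [h0]
        · calc Q.card * (3 * (1 + 3 * Q.card) ^ (d - 2))
              ≤ Q.card * (3 * (4 * Q.card) ^ (d - 2)) := by gcongr; omega
            _ = 3 * 4 ^ (d - 2) * Q.card ^ (d - 1) := by
              rw [show d - 1 = (d - 2) + 1 by omega, mul_pow, pow_succ]
              ring
            _ ≤ _ := by gcongr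
      have h3 : (incidences q A Q : ℝ) ≤
          2 * t * A.card + Q.card + 3 * 4 ^ (d - 2) * A.card := by
        exact_mod_cast h1.trans (by gcongr)
      have h4 : C₀ * (A.card + Q.card) = 2 * t * A.card + Q.card + 3 * 4 ^ (d - 2) * A.card +
          (A.card + (2 * t + 3 * 4 ^ (d - 2)) * Q.card) := by
        rw [hC₀]; ring
      have h5 : (0 : ℝ) ≤ A.card + (2 * t + 3 * 4 ^ (d - 2)) * Q.card := by positivity
      have := mul_nonneg hC0.le hXnn
      linarith
    by_cases hcase2 : A.card ^ 2 ≤ Q.card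
    · have h1 := (incidences_le_sq hfew).trans
        (Nat.add_le_add_left (Nat.mul_le_mul_left t hcase2) _)
      have h2 : (incidences q A Q : ℝ) ≤ Q.card + t * Q.card := by exact_mod_cast h1
      have h4 : C₀ * (A.card + Q.card) = Q.card + t * Q.card +
          (C₀ * A.card + (t + 3 * 4 ^ (d - 2)) * Q.card) := by
        rw [hC₀]; ring
      have h5 : (0 : ℝ) ≤ C₀ * A.card + (t + 3 * 4 ^ (d - 2)) * Q.card := by positivity
      have := mul_nonneg hC0.le hXnn
      linarith
    push Not at hcase1 hcase2
    have hQ0 : 0 < Q.card := by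
      by_contra h0
      rw [Nat.eq_zero_of_not_pos h0, zero_pow (by omega)] at hcase1
      omega
    have hA0 : 0 < A.card := by
      by_contra h0
      rw [Nat.eq_zero_of_not_pos h0] at hcase2
      simp at hcase2
    have hQ1 : (1 : ℝ) ≤ Q.card := by exact_mod_cast hQ0
    have hA1 : (1 : ℝ) ≤ A.card := by exact_mod_cast hA0
    set a : ℝ := (A.card : ℝ) with ha
    set m : ℝ := (Q.card : ℝ) with hm
    obtain ⟨haX, hmX⟩ : a ≤ a ^ (α + ε) * m ^ β ∧ m ≤ a ^ (α + ε) * m ^ β :=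
      le_main_term hd3 hε.le hA1 hQ1 (by rw [ha, hm]; exact_mod_cast hcase1.le)
        (by rw [ha, hm]; exact_mod_cast hcase2.le)
    set X := a ^ (α + ε) * m ^ β with hX
    have hlin : 0 ≤ C₀ * (a + m) := by positivity
    rcases Nat.lt_or_ge A.card K with hAK | hAK
    · have h1 : (incidences q A Q : ℝ) ≤ a * m := by
        rw [ha, hm]
        exact_mod_cast incidences_le_mul q A Q
      have h2 : a ≤ K := by rw [ha]; exact_mod_cast hAK.le
      calc (incidences q A Q : ℝ) ≤ a * m := h1
        _ ≤ C * X := mul_le_mul (h2.trans hCK) hmX (by linarith) hC0.le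
        _ ≤ _ := by linarith
    · obtain ⟨L, 𝓛, A', Q', h𝓛, hA', hQ', hAcard, hQcard, hsum, hinc⟩ :=
        incidences_le_sum_cutting hd hr0 hr1 hs hK (by omega) hfew (Finset.card_pos.1 hQ0) hAK
      rw [← ha] at hAcard
      rw [← hm] at hQcard
      have hstep : ∀ i, (incidences q (A' i) (Q' i) : ℝ) ≤
          C * (((2 / K : ℝ) ^ (α + ε) * r ^ β) * X) + C₀ * ((A' i).card + m) := by
        intro i
        have hlt : (A' i).card < n := by
          have h1 : (2 / K : ℝ) * a < a := by
            have : (2 / K : ℝ) < 1 := by rw [div_lt_one (by linarith)]; linarith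
            nlinarith
          have := (hAcard i).trans_lt h1
          rw [ha] at this
          rw [← hn]
          exact_mod_cast this
        have hih := ih _ hlt q (A' i) (Q' i) rfl (hfew.mono (hA' i) (hQ' i))
        have h1 : ((A' i).card : ℝ) ^ (α + ε) ≤ (2 / K : ℝ) ^ (α + ε) * a ^ (α + ε) := by
          rw [← Real.mul_rpow (by positivity) (by positivity)]
          exact Real.rpow_le_rpow (by positivity) (hAcard i) (by linarith)
        have h2 : ((Q' i).card : ℝ) ^ β ≤ r ^ β * m ^ β := by
          rw [← Real.mul_rpow hr0 (by positivity)]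
          exact Real.rpow_le_rpow (by positivity) (hQcard i) hβ0
        have h3 : ((Q' i).card : ℝ) ≤ m := by
          rw [hm]; exact_mod_cast Finset.card_le_card (hQ' i)
        have h4 : ((A' i).card : ℝ) ^ (α + ε) * ((Q' i).card : ℝ) ^ β ≤
            ((2 / K : ℝ) ^ (α + ε) * r ^ β) * X := by
          calc ((A' i).card : ℝ) ^ (α + ε) * ((Q' i).card : ℝ) ^ β
              ≤ ((2 / K : ℝ) ^ (α + ε) * a ^ (α + ε)) * (r ^ β * m ^ β) :=
                mul_le_mul h1 h2 (by positivity) (by positivity)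
            _ = (2 / K : ℝ) ^ (α + ε) * r ^ β * (a ^ (α + ε) * m ^ β) := by ring
        exact hih.trans (add_le_add (mul_le_mul_of_nonneg_left h4 hC0.le)
          (mul_le_mul_of_nonneg_left (by linarith) (by linarith)))
      set μ := (2 / K : ℝ) ^ (α + ε) * r ^ β with hμ
      have hμ0 : 0 ≤ μ := by positivity
      have h𝓛' : (𝓛.card : ℝ) ≤ 2 * K := by exact_mod_cast h𝓛
      have hsum' : ∑ i ∈ 𝓛, ((A' i).card : ℝ) = a := by rw [ha]; exact_mod_cast hsum
      have hinc' : (incidences q A Q : ℝ) ≤ (∑ i ∈ 𝓛, (incidences q (A' i) (Q' i) : ℝ)) + t * a +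
          𝓛.card * m := by rw [ha, hm]; exact_mod_cast hinc
      have hS : ∑ i ∈ 𝓛, (incidences q (A' i) (Q' i) : ℝ) ≤
          𝓛.card * (C * (μ * X)) + C₀ * (a + 𝓛.card * m) := by
        refine (Finset.sum_le_sum fun i _ => hstep i).trans (le_of_eq ?_)
        rw [Finset.sum_add_distrib, Finset.sum_const, ← Finset.mul_sum, Finset.sum_add_distrib,
          hsum', Finset.sum_const, nsmul_eq_mul, nsmul_eq_mul]
      have := absorb_lower_order hC0.le (by linarith) (Nat.cast_nonneg t) (by linarith)
        h𝓛' (by linarith) hmX haX hμ0 hcontr hC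
      linarith
  refine ⟨C + C₀, by linarith, fun q A Q hfew => (main _ q A Q rfl hfew).trans ?_⟩
  have hXnn : 0 ≤ (A.card : ℝ) ^ (α + ε) * (Q.card : ℝ) ^ β := by positivity
  have h1 : 0 ≤ C₀ * ((A.card : ℝ) ^ (α + ε) * (Q.card : ℝ) ^ β) := by positivity
  have h2 : 0 ≤ C * ((Q.card : ℝ) + A.card) := by positivity
  linarith

end MainBound

/-- Incidence bound for curves from a `d`-dimensional family of the form
`a₁·m₁ + ⋯ + a_d·m_d = 0`, assuming no `t` points of `P` lie on two distinct curves
(no `K_{t,2}` in the incidence graph). -/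
theorem pfaffian_family_incidences (d t : ℕ) (hd : 3 ≤ d) (ht : 2 ≤ t) (ε : ℝ) (hε : 0 < ε) :
    ∃ C : ℝ, 0 < C ∧
      ∀ (mfun : Fin d → (ℝ × ℝ) → ℝ) (A : Finset (Fin d → ℝ)) (P : Finset (ℝ × ℝ)) (m n : ℕ),
        A.card = n → P.card = m →
        (∀ a ∈ A, a ≠ 0) →
        (∀ a ∈ A, ∀ a' ∈ A, a ≠ a' → ∀ c : ℝ, a ≠ c • a') →
        (¬ ∃ T : Finset (ℝ × ℝ), T ⊆ P ∧ T.card = t ∧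
            ∃ a ∈ A, ∃ a' ∈ A, a ≠ a' ∧
              ∀ p ∈ T, (∑ i, a i * mfun i p = 0) ∧ (∑ i, a' i * mfun i p = 0)) →
        (Set.ncard {x : (Fin d → ℝ) × (ℝ × ℝ) |
            x.1 ∈ A ∧ x.2 ∈ P ∧ ∑ i, x.1 i * mfun i x.2 = 0} : ℝ) ≤
          C * ((n : ℝ) ^ ((2 * (d : ℝ) - 4) / (2 * (d : ℝ) - 3) + ε) *
                (m : ℝ) ^ (((d : ℝ) - 1) / (2 * (d : ℝ) - 3)) + (m : ℝ) + (n : ℝ)) := by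
  classical
  obtain ⟨C, hC, hbound⟩ := exists_incidences_bound (V := Fin d → ℝ) (P := ℝ × ℝ) hd (by simp) t hε
  refine ⟨C, hC, ?_⟩
  rintro mfun A P m n rfl rfl - - hfree
  let q : ℝ × ℝ → Module.Dual ℝ (Fin d → ℝ) := fun p => ∑ i, mfun i p • LinearMap.proj i
  have hq : ∀ p (a : Fin d → ℝ), q p a = ∑ i, a i * mfun i p := by
    intro p a
    simp [q, mul_comm]
  have hfew : FewCommon t q A P := by
    intro a ha a' ha' hne
    by_contra hcon
    push Not at hcon
    obtain ⟨T, hT, hTcard⟩ := Finset.exists_subset_card_eq hcon.le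
    refine hfree ⟨T, hT.trans (Finset.filter_subset _ _), hTcard, a, ha, a', ha', hne,
      fun p hp => ?_⟩
    simpa only [hq] using (Finset.mem_filter.1 (hT hp)).2
  refine le_trans (le_of_eq ?_) (hbound q A P hfew)
  rw [incidences, ← Set.ncard_coe_finset]
  congr 2
  ext x
  simp only [hq, Set.mem_ofPred_eq, Finset.coe_filter, Finset.mem_product, and_assoc]
end

section
/- Let d ≥ 3 and t ≥ 2 be integers and let ε > 0. There exists a constant C = C(d, t, ε) with the following property. Let Q be a set of n nonzero points in ℝ^d, no two of which are scalar multiples of each other, and let H be a set of m distinct (d−1)-dimensional linear subspaces of ℝ^d (hyperplanes through the origin). Assume that there do not exist 2 distinct points of Q and t distinct members of H such that both points lie in each of the t subspaces. Then the number of incidences |{ (q, h) ∈ Q × H : q ∈ h }| is at most C·( n^{(2d−4)/(2d−3)+ε} · m^{(d−1)/(2d−3)} + m + n ). -/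
namespace HyperplaneIncidence

open Module

section Arrangement

variable {V ι : Type*} [AddCommGroup V] [Module ℝ V]

/-- Moving a point `x` slightly in a direction `y` does not change the nonzero signs of finitely
many linear forms. -/
lemma exists_pos_small_perturbation [Finite ι] (f : ι → V →ₗ[ℝ] ℝ) (x y : V) :
    ∃ δ : ℝ, 0 < δ ∧ ∀ i, (0 < f i x → 0 < f i (x + δ • y)) ∧
      (f i x < 0 → f i (x + δ • y) < 0) := by
  have key : ∀ i, ∀ᶠ δ : ℝ in nhdsWithin 0 (Set.Ioi 0),
      (0 < f i x → 0 < f i (x + δ • y)) ∧ (f i x < 0 → f i (x + δ • y) < 0) := by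
    intro i
    have hlim : Filter.Tendsto (fun δ : ℝ => f i (x + δ • y)) (nhdsWithin 0 (Set.Ioi 0))
        (nhds (f i x)) := by
      have : Continuous (fun δ : ℝ => f i x + δ * f i y) := by fun_prop
      have h := (this.tendsto 0).mono_left (nhdsWithin_le_nhds (s := Set.Ioi 0))
      simpa using h
    rcases lt_trichotomy (f i x) 0 with h | h | h
    · filter_upwards [hlim.eventually (gt_mem_nhds h)] with δ hδ
      exact ⟨fun h' => absurd h' h.le.not_gt, fun _ => hδ⟩
    · exact Filter.Eventually.of_forall fun δ => ⟨fun h' => by linarith, fun h' => by linarith⟩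
    · filter_upwards [hlim.eventually (lt_mem_nhds h)] with δ hδ
      exact ⟨fun _ => hδ, fun h' => absurd h' h.le.not_gt⟩
  have hall := Filter.eventually_all.2 key
  obtain ⟨δ, hδ, h⟩ := (hall.and self_mem_nhdsWithin).exists
  exact ⟨δ, h, hδ⟩

/-- Every point of `W` can be moved to a generic point of `W` without changing the nonzero signs
of finitely many linear forms. -/
lemma exists_generic_perturbation [Finite ι] (f : ι → V →ₗ[ℝ] ℝ) (W : Submodule ℝ V) {x : V}
    (hx : x ∈ W) :
    ∃ w ∈ W, (∀ i, (0 < f i x → 0 < f i w) ∧ (f i x < 0 → f i w < 0)) ∧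
      ∀ i, f i w = 0 → W ≤ LinearMap.ker (f i) := by
  classical
  have := Fintype.ofFinite ι
  suffices h : ∀ s : Finset ι, ∃ w ∈ W,
      (∀ i, (0 < f i x → 0 < f i w) ∧ (f i x < 0 → f i w < 0)) ∧
      ∀ i ∈ s, f i w = 0 → W ≤ LinearMap.ker (f i) by
    simpa using h Finset.univ
  intro s
  induction s using Finset.induction_on with
  | empty => exact ⟨x, hx, fun i => ⟨id, id⟩, by simp⟩
  | insert a s _ ih =>
    obtain ⟨w, hw, hsign, hgen⟩ := ih
    by_cases ha : f a w = 0 → W ≤ LinearMap.ker (f a)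
    · refine ⟨w, hw, hsign, fun i hi => ?_⟩
      rcases Finset.mem_insert.1 hi with rfl | hi
      exacts [ha, hgen i hi]
    · push Not at ha
      obtain ⟨haw, haW⟩ := ha
      obtain ⟨y, hy, hay⟩ := SetLike.not_le_iff_exists.1 haW
      obtain ⟨δ, hδ, hp⟩ := exists_pos_small_perturbation f w y
      refine ⟨w + δ • y, W.add_mem hw (W.smul_mem _ hy), fun i =>
        ⟨fun h => (hp i).1 ((hsign i).1 h), fun h => (hp i).2 ((hsign i).2 h)⟩, fun i hi h0 => ?_⟩
      rcases Finset.mem_insert.1 hi with rfl | hi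
      · exfalso
        simp only [map_add, map_smul, haw, smul_eq_mul, zero_add, mul_eq_zero] at h0
        exact h0.elim hδ.ne' hay
      · apply hgen i hi
        by_contra hne
        rcases lt_or_gt_of_ne hne with h | h
        · exact ((hp i).2 h).ne h0
        · exact ((hp i).1 h).ne' h0

/-- Shooting a ray from a point `p` of a closed cell of `W` in a direction `-v`, where `v` lies in
the closed cell, it leaves the cell through a closed facet. The open cell is represented by the
generic point `w`, the open facet by `w'`. -/
lemma exists_facet [Finite ι] (l : ι → V →ₗ[ℝ] ℝ) (W : Submodule ℝ V) {w v p : V}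
    (hw : w ∈ W) (hgen : ∀ i, l i w = 0 → W ≤ LinearMap.ker (l i))
    (hv : v ∈ W) (hwv : ∀ i, 0 ≤ l i w * l i v) (hv0 : ∃ i, l i v ≠ 0)
    (hp : p ∈ W) (hwp : ∀ i, 0 ≤ l i w * l i p) :
    ∃ c : ℝ, 0 ≤ c ∧ ∃ h, ¬ W ≤ LinearMap.ker (l h) ∧
      ∃ w' ∈ W ⊓ LinearMap.ker (l h),
        (∀ i, l i w' = 0 → W ⊓ LinearMap.ker (l h) ≤ LinearMap.ker (l i)) ∧
        (∀ i, l i w' ≠ 0 → 0 < l i w * l i w') ∧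
        p - c • v ∈ W ⊓ LinearMap.ker (l h) ∧ ∀ i, 0 ≤ l i w' * l i (p - c • v) := by
  classical
  have := Fintype.ofFinite ι
  set a : ι → V →ₗ[ℝ] ℝ := fun i => l i w • l i with ha
  have hav : ∀ i, 0 ≤ a i v := hwv
  have hap : ∀ i, 0 ≤ a i p := hwp
  have hl0 : ∀ i, l i w = 0 → ∀ x ∈ W, l i x = 0 := fun i hi x hx => hgen i hi hx
  have hla : ∀ i, ∀ x ∈ W, a i x = 0 → l i x = 0 := by
    intro i x hx h
    rcases mul_eq_zero.1 (show l i w * l i x = 0 from h) with h | h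
    exacts [hl0 i h x hx, h]
  obtain ⟨u, hu, husign, hugen⟩ := exists_generic_perturbation
    (Sum.elim a (fun ij : ι × ι => a ij.1 v • a ij.2 - a ij.2 v • a ij.1)) W hw
  have hau : ∀ i, l i w ≠ 0 → 0 < a i u := fun i hi =>
    (husign (Sum.inl i)).1 (mul_self_pos.2 hi)
  set P : Finset ι := Finset.univ.filter fun i => 0 < a i v with hP
  have hPne : P.Nonempty := by
    obtain ⟨i, hi⟩ := hv0
    refine ⟨i, by
      simp only [hP, Finset.mem_filter, Finset.mem_univ, true_and]
      exact lt_of_le_of_ne (hav i) fun h => hi (hla i v hv h.symm)⟩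
  obtain ⟨h, hhP, hmin⟩ := P.exists_min_image
    (fun i => (toLex (a i p / a i v, a i u / a i v) : ℝ ×ₗ ℝ)) hPne
  have hhv : 0 < a h v := (Finset.mem_filter.1 hhP).2
  have hmin' : ∀ i, 0 < a i v → a h p / a h v < a i p / a i v ∨
      a h p / a h v = a i p / a i v ∧ a h u / a h v ≤ a i u / a i v := by
    intro i hi
    have := hmin i (Finset.mem_filter.2 ⟨Finset.mem_univ _, hi⟩)
    simpa [Prod.Lex.le_iff] using this
  set c := a h p / a h v with hc
  set μ := a h u / a h v with hμ
  set x := p - c • v with hx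
  set y := u - μ • v with hy
  have hxW : x ∈ W := W.sub_mem hp (W.smul_mem _ hv)
  have hyW : y ∈ W := W.sub_mem hu (W.smul_mem _ hv)
  have hahx : a h x = 0 := by
    simp only [hx, map_sub, map_smul, smul_eq_mul, hc]; field_simp; ring
  have hahy : a h y = 0 := by
    simp only [hy, map_sub, map_smul, smul_eq_mul, hμ]; field_simp; ring
  have hax : ∀ i, 0 ≤ a i x := by
    intro i
    simp only [hx, map_sub, map_smul, smul_eq_mul, sub_nonneg]
    rcases (hav i).lt_or_eq with hi | hi
    · rw [← le_div_iff₀ hi]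
      rcases hmin' i hi with h' | h'
      exacts [h'.le, h'.1.le]
    · rw [← hi, mul_zero]; exact hap i
  have hay : ∀ i, a i x = 0 → 0 ≤ a i y ∧
      (a i y = 0 → W ⊓ LinearMap.ker (l h) ≤ LinearMap.ker (l i)) := by
    intro i hi
    rcases (hav i).lt_or_eq with hiv | hiv
    · have htie : c = a i p / a i v := by
        simp only [hx, map_sub, map_smul, smul_eq_mul, sub_eq_zero] at hi
        rw [hi]; field_simp
      have hle : μ ≤ a i u / a i v := by
        rcases hmin' i hiv with h' | h'
        · exact absurd htie h'.ne
        · exact h'.2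
      refine ⟨?_, fun h0 z hz => ?_⟩
      · simp only [hy, map_sub, map_smul, smul_eq_mul, sub_nonneg]
        rwa [← le_div_iff₀ hiv]
      · have h1 : a i u = μ * a i v := by
          simpa only [hy, map_sub, map_smul, smul_eq_mul, sub_eq_zero] using h0
        have h2 := hugen (Sum.inr (h, i)) (by
          simp only [Sum.elim_inr, LinearMap.sub_apply, LinearMap.smul_apply, smul_eq_mul]
          rw [h1, hμ]; field_simp; ring) hz.1
        have hzh : a h z = 0 := by
          have : l h z = 0 := hz.2
          simp [ha, this]
        simp only [Sum.elim_inr, LinearMap.mem_ker, LinearMap.sub_apply, LinearMap.smul_apply,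
          smul_eq_mul, hzh, mul_zero, sub_zero, mul_eq_zero, hhv.ne', false_or] at h2
        exact hla i z hz.1 h2
    · have h1 : a i y = a i u := by
        simp [hy, ← hiv]
      rw [h1]
      by_cases hiw : l i w = 0
      · refine ⟨by simp [ha, hiw], fun _ => inf_le_left.trans (hgen i hiw)⟩
      · exact ⟨(hau i hiw).le, fun h' => absurd h' (hau i hiw).ne'⟩
  obtain ⟨δ, hδ, hpert⟩ := exists_pos_small_perturbation a x y
  set z := x + δ • y with hz
  have hzW : z ∈ W := W.add_mem hxW (W.smul_mem _ hyW)
  have haz : ∀ i, 0 ≤ a i z ∧ (a i z = 0 → W ⊓ LinearMap.ker (l h) ≤ LinearMap.ker (l i)) := by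
    intro i
    rcases (hax i).lt_or_eq with hi | hi
    · have := (hpert i).1 hi
      exact ⟨this.le, fun h' => absurd h' this.ne'⟩
    · have h1 : a i z = δ * a i y := by simp [hz, ← hi]
      rw [h1]
      exact ⟨mul_nonneg hδ.le (hay i hi.symm).1, fun h' =>
        (hay i hi.symm).2 ((mul_eq_zero.1 h').resolve_left hδ.ne')⟩
  have hhz : l h z = 0 := by
    apply hla h z hzW
    simp [hz, hahx, hahy]
  have hpos : ∀ i, l i z ≠ 0 → 0 < l i w * l i z := by
    intro i hi
    refine lt_of_le_of_ne (haz i).1 fun h' => hi ?_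
    exact hla i z hzW h'.symm
  refine ⟨c, div_nonneg (hap h) hhv.le, h, fun hle => ?_, z, ⟨hzW, hhz⟩, fun i hi => ?_, hpos,
    ⟨hxW, hla h x hxW hahx⟩, fun i => ?_⟩
  · have : l h v = 0 := hle hv
    simp [ha, this] at hhv
  · exact (haz i).2 (by simp [ha, hi])
  · by_cases hi : l i z = 0
    · simp [hi]
    · have h1 := hpos i hi
      have h2 : 0 ≤ l i w * l i x := hax i
      have h3 : 0 ≤ (l i w * l i w) * (l i z * l i x) := by nlinarith [mul_nonneg h1.le h2]
      have h4 : 0 < l i w * l i w := mul_self_pos.2 fun h' => by simp [h'] at h1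
      exact nonneg_of_mul_nonneg_right h3 h4

/-- The intersection of `W` with the kernel of a linear form not vanishing on `W`. -/
lemma finrank_inf_ker_add_one [FiniteDimensional ℝ V] (W : Submodule ℝ V) (f : V →ₗ[ℝ] ℝ)
    (h : ¬ W ≤ LinearMap.ker f) :
    finrank ℝ ↥(W ⊓ LinearMap.ker f) + 1 = finrank ℝ W := by
  have hne : f.domRestrict W ≠ 0 := fun h0 => h fun x hx => by
    simpa using LinearMap.congr_fun h0 ⟨x, hx⟩
  have h1 := Module.Dual.finrank_ker_add_one_of_ne_zero hne
  have hmap : W ⊓ LinearMap.ker f = (LinearMap.ker (f.domRestrict W)).map W.subtype := by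
    ext x
    simp only [Submodule.mem_inf, LinearMap.mem_ker, Submodule.mem_map, Submodule.subtype_apply]
    constructor
    · rintro ⟨hx, hf⟩
      exact ⟨⟨x, hx⟩, by simpa using hf, rfl⟩
    · rintro ⟨y, hy, rfl⟩
      exact ⟨y.2, by simpa using hy⟩
  rw [← h1, hmap, Submodule.finrank_map_subtype_eq]

/-- The flat cut out by the linear forms indexed by `T`. -/
def flat (l : ι → V →ₗ[ℝ] ℝ) (T : Finset ι) : Submodule ℝ V := T.inf fun i => LinearMap.ker (l i)

lemma flat_insert [DecidableEq ι] (l : ι → V →ₗ[ℝ] ℝ) (T : Finset ι) (h : ι) :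
    flat l (insert h T) = flat l T ⊓ LinearMap.ker (l h) := by
  rw [flat, Finset.inf_insert, inf_comm]; rfl

lemma mem_flat {l : ι → V →ₗ[ℝ] ℝ} {T : Finset ι} {x : V} : x ∈ flat l T ↔ ∀ i ∈ T, l i x = 0 := by
  simp [flat, Submodule.mem_finsetInf]

/-- The point `x` satisfies weakly all the sign conditions prescribed by `σ`. -/
def InClosedCell (l : ι → V →ₗ[ℝ] ℝ) (σ : ι → SignType) (x : V) : Prop :=
  ∀ i, l i x = 0 ∨ SignType.sign (l i x) = σ i

/-- The sign vector of a point. -/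
noncomputable def signVector (l : ι → V →ₗ[ℝ] ℝ) (x : V) : ι → SignType :=
  fun i => SignType.sign (l i x)

lemma sign_eq_sign_of_mul_pos {a b : ℝ} (h : 0 < a * b) :
    SignType.sign a = SignType.sign b := by
  rcases mul_pos_iff.1 h with ⟨ha, hb⟩ | ⟨ha, hb⟩
  · rw [sign_pos ha, sign_pos hb]
  · rw [sign_neg ha, sign_neg hb]

lemma mul_nonneg_of_sign_eq {a b : ℝ} (h : b = 0 ∨ SignType.sign b = SignType.sign a) :
    0 ≤ a * b := by
  rcases h with h | h
  · simp [h]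
  · rcases lt_trichotomy a 0 with ha | rfl | ha
    · rw [sign_neg ha, sign_eq_neg_one_iff] at h
      exact (mul_pos_of_neg_of_neg ha h).le
    · simp
    · rw [sign_pos ha, sign_eq_one_iff] at h
      exact (mul_pos ha h).le

lemma InClosedCell.mem_flat {l : ι → V →ₗ[ℝ] ℝ} {T : Finset ι} {w x : V} (hw : w ∈ flat l T)
    (hx : InClosedCell l (signVector l w) x) : x ∈ flat l T := by
  rw [HyperplaneIncidence.mem_flat] at hw ⊢
  intro i hi
  rcases hx i with h | h
  · exact h
  · rwa [signVector, hw i hi, sign_zero, sign_eq_zero_iff] at h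

lemma inClosedCell_of_mul_nonneg {l : ι → V →ₗ[ℝ] ℝ} {W : Submodule ℝ V} {w x : V}
    (hgen : ∀ i, l i w = 0 → W ≤ LinearMap.ker (l i)) (hx : x ∈ W)
    (h : ∀ i, 0 ≤ l i w * l i x) : InClosedCell l (signVector l w) x := by
  intro i
  by_cases hi : l i w * l i x = 0
  · rcases mul_eq_zero.1 hi with hi | hi
    exacts [Or.inl (hgen i hi hx), Or.inl hi]
  · exact Or.inr (sign_eq_sign_of_mul_pos (lt_of_le_of_ne (h i) (Ne.symm hi))).symm

/-- A closed face is contained in the closed cell. -/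
lemma InClosedCell.of_face {l : ι → V →ₗ[ℝ] ℝ} {w w' x : V}
    (hface : ∀ i, l i w' ≠ 0 → 0 < l i w * l i w')
    (hx : InClosedCell l (signVector l w') x) : InClosedCell l (signVector l w) x := by
  intro i
  by_cases hi : l i w' = 0
  · left
    simpa [signVector, hi] using hx i
  · exact (hx i).imp_right fun h => h.trans (sign_eq_sign_of_mul_pos (hface i hi)).symm

/-- Every closed cell of positive dimension contains a vertex, that is, a nonzero vector of a
one-dimensional flat. -/
lemma exists_vertex [FiniteDimensional ℝ V] [Finite ι] (l : ι → V →ₗ[ℝ] ℝ)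
    (hsep : ∀ x, (∀ i, l i x = 0) → x = 0) (e : ℕ) :
    ∀ T : Finset ι, finrank ℝ (flat l T) = e + 1 → ∀ w ∈ flat l T,
      (∀ i, l i w = 0 → flat l T ≤ LinearMap.ker (l i)) →
      ∃ v, v ≠ 0 ∧ InClosedCell l (signVector l w) v ∧
        ∃ T', finrank ℝ (flat l T') = 1 ∧ v ∈ flat l T' := by
  classical
  have hne : ∀ T : Finset ι, ∀ e : ℕ, finrank ℝ (flat l T) = e + 1 → ∀ w ∈ flat l T,
      (∀ i, l i w = 0 → flat l T ≤ LinearMap.ker (l i)) → w ≠ 0 := by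
    rintro T e hT w - hgen rfl
    have : flat l T = ⊥ := by
      rw [eq_bot_iff]
      exact fun x hx => hsep x fun i => hgen i (map_zero _) hx
    rw [this, finrank_bot] at hT
    omega
  induction e with
  | zero =>
    intro T hT w hw hgen
    exact ⟨w, hne T 0 hT w hw hgen, fun i => Or.inr rfl, T, hT, hw⟩
  | succ e ih =>
    intro T hT w hw hgen
    have hw0 := hne T _ hT w hw hgen
    obtain ⟨-, -, h, hh, w', hw', hgen', hface, -⟩ := exists_facet l (flat l T) hw hgen hw
      (fun i => mul_self_nonneg _) (by
        by_contra! hall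
        exact hw0 (hsep w hall)) hw (fun i => mul_self_nonneg _)
    rw [← flat_insert] at hw' hgen'
    have hfr := finrank_inf_ker_add_one _ _ hh
    rw [← flat_insert] at hfr
    obtain ⟨v, hv0, hv, hT'⟩ := ih _ (by omega) w' hw' hgen'
    exact ⟨v, hv0, hv.of_face hface, hT'⟩

/-- The cells of the bottom-vertex triangulation, with the vertices `bot σ` of cells `σ`, of an
arrangement restricted to a flat of dimension `e + 1`. -/
lemma exists_triangulation_flat [FiniteDimensional ℝ V] [Fintype ι] (l : ι → V →ₗ[ℝ] ℝ)
    (hsep : ∀ x, (∀ i, l i x = 0) → x = 0) (X : Set V) (bot : (ι → SignType) → V)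
    (hbot : ∀ T : Finset ι, 0 < finrank ℝ (flat l T) → ∀ w ∈ flat l T,
      (∀ i, l i w = 0 → flat l T ≤ LinearMap.ker (l i)) →
      bot (signVector l w) ∈ X ∧ bot (signVector l w) ≠ 0 ∧
        InClosedCell l (signVector l w) (bot (signVector l w)))
    (e : ℕ) :
    ∀ T : Finset ι, finrank ℝ (flat l T) = e + 1 →
      ∃ S : Finset ((ι → SignType) × Finset V), S.card ≤ 2 * (2 * Fintype.card ι) ^ e ∧
        ∀ w ∈ flat l T, (∀ i, l i w = 0 → flat l T ≤ LinearMap.ker (l i)) →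
        ∀ p, InClosedCell l (signVector l w) p →
        ∃ τ, (signVector l w, τ) ∈ S ∧ p ∈ Submodule.span NNReal (τ : Set V) ∧
          τ.card ≤ e + 1 ∧ (τ : Set V) ⊆ X ∧
          ∀ v ∈ τ, InClosedCell l (signVector l w) v := by
  classical
  induction e with
  | zero =>
    intro T hT
    obtain ⟨⟨w₀, hw₀⟩, -, hspan⟩ := finrank_eq_one_iff'.1 hT
    refine ⟨{(signVector l w₀, {bot (signVector l w₀)}),
      (signVector l (-w₀), {bot (signVector l (-w₀))})}, by simpa using Finset.card_le_two, ?_⟩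
    intro w hw hgen p hp
    obtain ⟨hbX, hb0, hb⟩ := hbot T (by omega) w hw hgen
    have hpW := hp.mem_flat hw
    have hbW := hb.mem_flat hw
    have hline : ∀ x ∈ flat l T, ∃ c : ℝ, x = c • w₀ := fun x hx => by
      obtain ⟨c, hc⟩ := hspan ⟨x, hx⟩
      exact ⟨c, (congrArg Subtype.val hc).symm⟩
    refine ⟨{bot (signVector l w)}, ?_, ?_, by simp, by simpa using hbX, by simpa using hb⟩
    · obtain ⟨c, rfl⟩ := hline w hw
      have hc : c ≠ 0 := by
        rintro rfl
        exact hb0 (hsep _ fun i => hgen i (by simp) hbW)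
      rcases lt_or_gt_of_ne hc with hc | hc
      · have : signVector l (c • w₀) = signVector l (-w₀) := by
          ext1 i
          simp [signVector, sign_mul, sign_neg hc, Left.sign_neg]
        simp [this]
      · have : signVector l (c • w₀) = signVector l w₀ := by
          ext1 i
          simp [signVector, sign_mul, sign_pos hc]
        simp [this]
    · obtain ⟨β, hβ⟩ := hline _ hbW
      obtain ⟨γ, rfl⟩ := hline p hpW
      have hβ0 : β ≠ 0 := by
        rintro rfl
        exact hb0 (by simpa using hβ)
      obtain ⟨i, hi⟩ : ∃ i, l i (bot (signVector l w)) ≠ 0 := by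
        by_contra! hall
        exact hb0 (hsep _ hall)
      have h1 : 0 ≤ l i (bot (signVector l w)) * l i (γ • w₀) := by
        apply mul_nonneg_of_sign_eq
        exact (hp i).imp_right fun h => h.trans ((hb i).resolve_left hi).symm
      rw [hβ] at hi h1
      simp only [map_smul, smul_eq_mul] at hi h1
      have hlw : l i w₀ ≠ 0 := right_ne_zero_of_mul hi
      have h2 : 0 ≤ β * γ := by
        have h3 : 0 < l i w₀ * l i w₀ := mul_self_pos.2 hlw
        have h4 : 0 ≤ (l i w₀ * l i w₀) * (β * γ) := by linarith
        exact nonneg_of_mul_nonneg_right h4 h3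
      have h3 : 0 ≤ γ / β := by
        rw [div_eq_mul_inv, ← mul_self_mul_inv β⁻¹, inv_inv]
        nlinarith [mul_nonneg h2 (mul_self_nonneg β⁻¹)]
      rw [Finset.coe_singleton, Submodule.mem_span_singleton]
      refine ⟨(γ / β).toNNReal, ?_⟩
      rw [hβ, NNReal.smul_def, Real.coe_toNNReal _ h3, smul_smul]
      congr 1
      exact div_mul_cancel₀ γ hβ0
  | succ e ih =>
    intro T hT
    have hfr : ∀ h, ¬ flat l T ≤ LinearMap.ker (l h) →
        finrank ℝ (flat l (insert h T)) = e + 1 := by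
      intro h hh
      have := finrank_inf_ker_add_one _ _ hh
      rw [flat_insert]
      omega
    have hex : ∀ h, ∃ S : Finset ((ι → SignType) × Finset V),
        S.card ≤ 2 * (2 * Fintype.card ι) ^ e ∧ ∃ u ∈ flat l T, ¬ flat l T ≤ LinearMap.ker (l h) →
        l h u = 1 ∧
        ∀ w ∈ flat l (insert h T),
        (∀ i, l i w = 0 → flat l (insert h T) ≤ LinearMap.ker (l i)) →
        ∀ p, InClosedCell l (signVector l w) p →
        ∃ τ, (signVector l w, τ) ∈ S ∧ p ∈ Submodule.span NNReal (τ : Set V) ∧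
          τ.card ≤ e + 1 ∧ (τ : Set V) ⊆ X ∧
          ∀ v ∈ τ, InClosedCell l (signVector l w) v := by
      intro h
      by_cases hh : flat l T ≤ LinearMap.ker (l h)
      · exact ⟨∅, by simp, 0, Submodule.zero_mem _, fun h' => absurd hh h'⟩
      · obtain ⟨S, hS, hS'⟩ := ih _ (hfr h hh)
        obtain ⟨u, hu, hu0⟩ := SetLike.not_le_iff_exists.1 hh
        refine ⟨S, hS, (l h u)⁻¹ • u, Submodule.smul_mem _ _ hu, fun _ => ⟨?_, hS'⟩⟩
        rw [map_smul, smul_eq_mul, inv_mul_cancel₀ hu0]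
    choose S hScard u hu hS using hex
    let ext : ι → (ι → SignType) → SignType → ι → SignType := fun h σ' b k =>
      if σ' k ≠ 0 then σ' k else b * SignType.sign (l k (u h))
    let g : (ι × SignType) × ((ι → SignType) × Finset V) → (ι → SignType) × Finset V := fun x =>
      (ext x.1.1 x.2.1 x.1.2, insert (bot (ext x.1.1 x.2.1 x.1.2)) x.2.2)
    refine ⟨(Finset.univ ×ˢ {1, -1}).biUnion fun hb : ι × SignType =>
      (S hb.1).image fun y => g (hb, y), ?_, ?_⟩
    · refine (Finset.card_biUnion_le_card_mul _ _ (2 * (2 * Fintype.card ι) ^ e) fun hb _ =>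
        Finset.card_image_le.trans (hScard _)).trans ?_
      rw [Finset.card_product, Finset.card_univ, show ({1, -1} : Finset SignType).card = 2 from rfl,
        pow_succ]
      exact le_of_eq (by ring)
    · intro w hw hgen p hp
      obtain ⟨hbX, hb0, hb⟩ := hbot T (by omega) w hw hgen
      obtain ⟨c, hc, h, hh, w', hw', hgen', hface, hx, hxw⟩ := exists_facet l (flat l T) hw hgen
        (hb.mem_flat hw) (fun i => mul_nonneg_of_sign_eq (hb i)) (by
          by_contra! hall
          exact hb0 (hsep _ hall)) (hp.mem_flat hw) (fun i => mul_nonneg_of_sign_eq (hp i))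
      rw [← flat_insert] at hw' hgen' hx
      obtain ⟨hu1, hSh⟩ := hS h hh
      obtain ⟨τ, hτS, hτspan, hτcard, hτbot, hτcell⟩ := hSh w' hw' hgen' _
        (inClosedCell_of_mul_nonneg hgen' hx hxw)
      have hext : ext h (signVector l w') (SignType.sign (l h w)) = signVector l w := by
        ext1 k
        by_cases hk : l k w' = 0
        · have h1 := hgen' k hk
          have h2 : w - l h w • u h ∈ flat l (insert h T) := by
            rw [flat_insert]
            exact ⟨Submodule.sub_mem _ hw (Submodule.smul_mem _ _ (hu h)), by simp [hu1]⟩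
          have h3 : l k w = l h w * l k (u h) := by
            simpa [sub_eq_zero] using h1 h2
          simp [ext, signVector, hk, h3, sign_mul]
        · simp only [ext, signVector, ne_eq, sign_eq_zero_iff, hk, not_false_eq_true, if_true]
          exact (sign_eq_sign_of_mul_pos (hface k hk)).symm
      refine ⟨insert (bot (signVector l w)) τ, ?_, ?_, ?_, ?_, ?_⟩
      · rw [Finset.mem_biUnion]
        refine ⟨(h, SignType.sign (l h w)), ?_, Finset.mem_image.2 ⟨_, hτS, ?_⟩⟩
        · have : l h w ≠ 0 := fun h0 => hh (hgen h h0)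
          rcases lt_or_gt_of_ne this with h0 | h0
          · simp [sign_neg h0]
          · simp [sign_pos h0]
        · simp only [g, hext]
      · rw [Finset.coe_insert, Submodule.mem_span_insert]
        refine ⟨c.toNNReal, _, hτspan, ?_⟩
        rw [NNReal.smul_def, Real.coe_toNNReal _ hc]
        simp
      · exact (Finset.card_insert_le _ _).trans (by omega)
      · rw [Finset.coe_insert]
        exact Set.insert_subset hbX hτbot
      · intro v hv
        rcases Finset.mem_insert.1 hv with rfl | hv
        exacts [hb, (hτcell v hv).of_face hface]

end Arrangement

/-- Greedy hitting sets: if each member of `U` is hit by a proportion at least `x` of `H`, then few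
elements of `H` hit every member of `U`. -/
lemma exists_hitting_set {α β : Type*} [DecidableEq α] (H : Finset α) (hH : H.Nonempty)
    (r : β → α → Prop) [∀ b a, Decidable (r b a)] (x : ℝ) (hx : x ≤ 1) (s : ℕ) :
    ∀ U : Finset β, (∀ u ∈ U, x * H.card ≤ (H.filter (r u)).card) → U.card * (1 - x) ^ s < 1 →
      ∃ R ⊆ H, R.card ≤ s ∧ ∀ u ∈ U, ∃ h ∈ R, r u h := by
  classical
  induction s with
  | zero =>
    intro U _ hU
    have : U = ∅ := by
      rw [← Finset.card_eq_zero]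
      have : (U.card : ℝ) < 1 := by simpa using hU
      exact_mod_cast Nat.lt_one_iff.1 (by exact_mod_cast this)
    exact ⟨∅, by simp, by simp, by simp [this]⟩
  | succ s ih =>
    intro U hU hcard
    have hsum : (∑ h ∈ H, x * U.card : ℝ) ≤ ∑ h ∈ H, ((U.filter fun u => r u h).card : ℝ) := by
      have h1 : ∑ u ∈ U, (H.filter (r u)).card = ∑ h ∈ H, (U.filter fun u => r u h).card :=
        Finset.sum_card_bipartiteAbove_eq_sum_card_bipartiteBelow r
      have h2 : (U.card * (x * H.card) : ℝ) ≤ ∑ u ∈ U, ((H.filter (r u)).card : ℝ) := by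
        rw [← nsmul_eq_mul]
        exact Finset.card_nsmul_le_sum _ _ _ hU
      rw [Finset.sum_const, nsmul_eq_mul]
      calc (H.card * (x * U.card) : ℝ) = U.card * (x * H.card) := by ring
        _ ≤ _ := h2
        _ = _ := by exact_mod_cast h1
    obtain ⟨h, hh, hle⟩ := Finset.exists_le_of_sum_le hH hsum
    have hsplit := Finset.card_filter_add_card_filter_not (s := U) (fun u => r u h)
    obtain ⟨R, hR, hRs, hhit⟩ := ih (U.filter fun u => ¬ r u h)
      (fun u hu => hU u (Finset.mem_filter.1 hu).1) (by
        refine lt_of_le_of_lt ?_ hcard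
        rw [pow_succ', ← mul_assoc]
        refine mul_le_mul_of_nonneg_right ?_ (pow_nonneg (by linarith) _)
        have : ((U.filter fun u => r u h).card : ℝ) + (U.filter fun u => ¬ r u h).card =
            U.card := by
          exact_mod_cast hsplit
        linarith)
    refine ⟨insert h R, Finset.insert_subset hh hR,
      (Finset.card_insert_le _ _).trans (by omega), fun u hu => ?_⟩
    by_cases hr : r u h
    · exact ⟨h, Finset.mem_insert_self _ _, hr⟩
    · obtain ⟨h', hh', hr'⟩ := hhit u (Finset.mem_filter.2 ⟨hu, hr⟩)
      exact ⟨h', Finset.mem_insert_of_mem hh', hr'⟩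

section Hyperplanes

variable {V : Type*} [AddCommGroup V] [Module ℝ V] [FiniteDimensional ℝ V]

/-- An intersection of hyperplanes is an intersection of at most codimension many of them. -/
lemma exists_subset_inf_eq {D : ℕ} {S : Finset (Submodule ℝ V)}
    (hS : S.Nonempty) (hD : ∀ h ∈ S, finrank ℝ h = D) :
    ∃ B ⊆ S, B.Nonempty ∧ B.inf id = S.inf id ∧ B.card + finrank ℝ ↥(B.inf id) ≤ D + 1 := by
  classical
  induction hS using Finset.Nonempty.cons_induction with
  | singleton a =>
    refine ⟨{a}, subset_rfl, by simp, rfl, ?_⟩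
    have := hD a (by simp)
    rw [Finset.card_singleton, Finset.inf_singleton, id]
    omega
  | cons a S ha hS ih =>
    obtain ⟨B, hBS, hB, hinf, hcard⟩ := ih fun h hh => hD h (Finset.mem_cons_of_mem hh)
    rw [Finset.inf_cons, ← hinf, id]
    by_cases hle : B.inf id ≤ a
    · exact ⟨B, hBS.trans (Finset.subset_cons ha), hB, (inf_eq_right.2 hle).symm, hcard⟩
    · refine ⟨insert a B, ?_, Finset.insert_nonempty _ _, by rw [Finset.inf_insert, id], ?_⟩
      · rw [Finset.cons_eq_insert]
        exact Finset.insert_subset_insert _ hBS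
      · have hlt : finrank ℝ ↥(a ⊓ B.inf id) < finrank ℝ ↥(B.inf id) :=
          Submodule.finrank_lt_finrank_of_lt
            (lt_of_le_of_ne inf_le_right fun h => hle (inf_eq_right.1 h))
        have := Finset.card_insert_le a B
        rw [Finset.inf_insert, id]
        omega

lemma exists_fin_fun_range_eq {α : Type*} {B : Finset α} (hB : B.Nonempty) {D : ℕ}
    (hD : B.card ≤ D) : ∃ g : Fin D → α, (∀ i, g i ∈ B) ∧ ∀ b ∈ B, ∃ i, g i = b := by
  obtain ⟨b₀, hb₀⟩ := hB
  refine ⟨fun i => if h : (i : ℕ) < B.card then B.equivFin.symm ⟨i, h⟩ else b₀, fun i => ?_,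
    fun b hb => ?_⟩
  · dsimp only
    split_ifs
    exacts [Subtype.mem _, hb₀]
  · refine ⟨⟨B.equivFin ⟨b, hb⟩, (Fin.is_lt _).trans_le hD⟩, ?_⟩
    simp

/-- A nonzero intersection of hyperplanes in dimension `D + 1` is the intersection of `D` of
them. -/
lemma exists_iInf_fin_eq {D : ℕ} {S : Finset (Submodule ℝ V)}
    (hS : S.Nonempty) (hD : ∀ h ∈ S, finrank ℝ h = D) (hpos : 0 < finrank ℝ ↥(S.inf id)) :
    ∃ g : Fin D → Submodule ℝ V, (∀ i, g i ∈ S) ∧ ⨅ i, g i = S.inf id := by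
  obtain ⟨B, hBS, hB, hinf, hcard⟩ := exists_subset_inf_eq hS hD
  rw [hinf] at hcard
  obtain ⟨g, hg, hg'⟩ := exists_fin_fun_range_eq hB (D := D) (by omega)
  refine ⟨g, fun i => hBS (hg i), le_antisymm ?_ ?_⟩
  · rw [← hinf]
    refine Finset.le_inf fun b hb => ?_
    obtain ⟨i, rfl⟩ := hg' b hb
    exact iInf_le _ _
  · exact le_iInf fun i => Finset.inf_le (f := id) (hBS (hg i))

/-- The one-dimensional intersections of `D`-tuples of a finite family of hyperplanes are spanned,
up to sign, by few vectors. -/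
lemma exists_vertex_set {D : ℕ} (hV : finrank ℝ V = D + 1) (hD0 : 1 ≤ D)
    (G : Finset (Submodule ℝ V)) (hG : ∀ h ∈ G, finrank ℝ h = D) :
    ∃ X : Finset V, X.card ≤ 2 * G.card ^ D ∧
      ∀ S ⊆ G, finrank ℝ ↥(S.inf id) = 1 → ∀ x ∈ S.inf id, x ≠ 0 →
        ∃ v ∈ X, ∃ c : ℝ, 0 < c ∧ x = c • v := by
  classical
  have hrep : ∀ W : Submodule ℝ V, ∃ w : V, finrank ℝ W = 1 →
      w ≠ 0 ∧ ∀ x ∈ W, ∃ c : ℝ, x = c • w := by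
    intro W
    by_cases hW : finrank ℝ W = 1
    · obtain ⟨⟨w, hw⟩, hw0, hspan⟩ := finrank_eq_one_iff'.1 hW
      refine ⟨w, fun _ => ⟨fun h => hw0 (by simp [h]), fun x hx => ?_⟩⟩
      obtain ⟨c, hc⟩ := hspan ⟨x, hx⟩
      exact ⟨c, (congrArg Subtype.val hc).symm⟩
    · exact ⟨0, fun h => absurd h hW⟩
  choose rep hrep using hrep
  refine ⟨(({1, -1} : Finset ℝ) ×ˢ Fintype.piFinset fun _ : Fin D => G).image
    fun x => x.1 • rep (⨅ i, x.2 i), ?_, ?_⟩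
  · refine Finset.card_image_le.trans ?_
    rw [Finset.card_product, Fintype.card_piFinset_const]
    exact Nat.mul_le_mul_right _ Finset.card_le_two
  · intro S hSG hS x hx hx0
    have hSne : S.Nonempty := by
      rw [Finset.nonempty_iff_ne_empty]
      rintro rfl
      rw [Finset.inf_empty, finrank_top] at hS
      omega
    obtain ⟨g, hg, hgS⟩ := exists_iInf_fin_eq hSne (fun h hh => hG h (hSG hh)) (by omega)
    obtain ⟨-, hspan⟩ := hrep _ hS
    obtain ⟨c, hc⟩ := hspan x hx
    have hmem : ∀ b ∈ ({1, -1} : Finset ℝ), b • rep (S.inf id) ∈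
        (({1, -1} : Finset ℝ) ×ˢ Fintype.piFinset fun _ : Fin D => G).image
          fun x => x.1 • rep (⨅ i, x.2 i) := fun b hb =>
      Finset.mem_image.2 ⟨(b, g), Finset.mem_product.2 ⟨hb, Fintype.mem_piFinset.2 fun i =>
        hSG (hg i)⟩, by rw [hgS]⟩
    have hc0 : c ≠ 0 := by
      rintro rfl
      exact hx0 (by simpa using hc)
    rcases lt_or_gt_of_ne hc0 with h | h
    · exact ⟨_, hmem (-1) (by simp), -c, by linarith, by rw [smul_smul, hc]; simp⟩
    · exact ⟨_, hmem 1 (by simp), c, h, by rw [one_smul, hc]⟩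

/-- Finitely many coordinate hyperplanes intersecting trivially. -/
lemma exists_coordinate_hyperplanes {D : ℕ} (hV : finrank ℝ V = D + 1) :
    ∃ E : Finset (Submodule ℝ V), E.card ≤ D + 1 ∧ (∀ h ∈ E, finrank ℝ h = D) ∧
      ∀ x, (∀ h ∈ E, x ∈ h) → x = 0 := by
  classical
  let b := finBasisOfFinrankEq ℝ V hV
  refine ⟨Finset.univ.image fun i => LinearMap.ker (b.coord i), ?_, ?_, fun x hx => ?_⟩
  · exact Finset.card_image_le.trans (by simp)
  · intro h hh
    obtain ⟨i, -, rfl⟩ := Finset.mem_image.1 hh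
    have hne : b.coord i ≠ 0 := fun h0 => by
      simpa using LinearMap.congr_fun h0 (b i)
    have := Module.Dual.finrank_ker_add_one_of_ne_zero hne
    omega
  · refine b.ext_elem fun i => ?_
    simpa using hx _ (Finset.mem_image_of_mem _ (Finset.mem_univ i))

lemma exists_ker_eq {D : ℕ} (hV : finrank ℝ V = D + 1) {h : Submodule ℝ V}
    (hh : finrank ℝ h = D) : ∃ f : V →ₗ[ℝ] ℝ, LinearMap.ker f = h := by
  have hlt : h < ⊤ := lt_top_iff_ne_top.2 fun h' => by
    rw [h', finrank_top] at hh
    omega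
  obtain ⟨f, hf0, hf⟩ := Submodule.exists_le_ker_of_lt_top h hlt
  refine ⟨f, (Submodule.eq_of_le_of_finrank_eq hf ?_).symm⟩
  have := Module.Dual.finrank_ker_add_one_of_ne_zero hf0
  omega

/-- The cutting lemma: space is partitioned into few cells, each of which is crossed by few of the
hyperplanes of `H`. -/
lemma exists_cutting {D : ℕ} (hV : finrank ℝ V = D + 1) (hD0 : 1 ≤ D)
    (H : Finset (Submodule ℝ V)) (hH : H.Nonempty) (hHD : ∀ h ∈ H, finrank ℝ h = D)
    (s : ℕ) (x : ℝ) (hx0 : 0 ≤ x) (hx1 : x ≤ 1)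
    (hs : ((2 * (H.card + D + 1) ^ D) ^ 2 : ℝ) * (1 - x) ^ s < 1) :
    ∃ (cell : V → Finset V) (F : Finset (Finset V)), (∀ p, cell p ∈ F) ∧
      F.card ≤ 2 * (2 * (s + D + 1)) ^ D * 2 ^ (D + 1) ∧
      ∀ τ ∈ F, ∀ H' ⊆ H, (∀ h ∈ H', ∃ p q, cell p = τ ∧ cell q = τ ∧ p ∈ h ∧ q ∉ h) →
        (H'.card : ℝ) ≤ (D + 1) ^ 2 * (x * H.card) := by
  classical
  obtain ⟨E, hEcard, hED, hE0⟩ := exists_coordinate_hyperplanes hV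
  have hφ : ∀ h : Submodule ℝ V, ∃ f : V →ₗ[ℝ] ℝ, finrank ℝ h = D → LinearMap.ker f = h := by
    intro h
    by_cases hh : finrank ℝ h = D
    · obtain ⟨f, hf⟩ := exists_ker_eq hV hh
      exact ⟨f, fun _ => hf⟩
    · exact ⟨0, fun h' => absurd h' hh⟩
  choose φ hφ using hφ
  obtain ⟨X, hXcard, hX⟩ := exists_vertex_set hV hD0 (H ∪ E) (by
    intro h hh
    rcases Finset.mem_union.1 hh with hh | hh
    exacts [hHD h hh, hED h hh])
  set sep : V × V → Submodule ℝ V → Prop := fun u h => φ h u.1 < 0 ∧ 0 < φ h u.2 with hsep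
  set U : Finset (V × V) := (X ×ˢ X).filter fun u => x * H.card ≤ (H.filter (sep u)).card with hU
  have hUcard : (U.card : ℝ) ≤ (2 * (H.card + D + 1) ^ D) ^ 2 := by
    have h1 : U.card ≤ X.card ^ 2 := by
      rw [sq, ← Finset.card_product]
      exact Finset.card_filter_le _ _
    have h2 : X.card ≤ 2 * (H.card + D + 1) ^ D := by
      refine hXcard.trans (Nat.mul_le_mul_left _ (Nat.pow_le_pow_left ?_ _))
      exact (Finset.card_union_le _ _).trans (by omega)
    exact_mod_cast h1.trans (Nat.pow_le_pow_left h2 2)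
  obtain ⟨R, hRH, hRs, hRU⟩ := exists_hitting_set H hH sep x hx1 s U
    (fun u hu => (Finset.mem_filter.1 hu).2)
    (lt_of_le_of_lt (mul_le_mul_of_nonneg_right hUcard (pow_nonneg (by linarith) _)) hs)
  have hRED : ∀ h ∈ R ∪ E, finrank ℝ h = D := by
    intro h hh
    rcases Finset.mem_union.1 hh with hh | hh
    exacts [hHD h (hRH hh), hED h hh]
  let l : ↥(R ∪ E) → V →ₗ[ℝ] ℝ := fun i => φ i
  have hlker : ∀ i, LinearMap.ker (l i) = i := fun i => hφ i (hRED i i.2)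
  have hl0 : ∀ x, (∀ i, l i x = 0) → x = 0 := by
    intro x hx
    refine hE0 x fun h hh => ?_
    have := hx ⟨h, Finset.mem_union_right _ hh⟩
    rw [← hφ h (hED h hh)]
    exact this
  have hflat : ∀ T : Finset ↥(R ∪ E), flat l T = (T.image Subtype.val).inf id := by
    intro T
    rw [Finset.inf_image, flat]
    exact Finset.inf_congr rfl fun i _ => hlker i
  have hbot : ∀ σ, ∃ v, (∃ v ∈ X, v ≠ 0 ∧ InClosedCell l σ v) →
      v ∈ X ∧ v ≠ 0 ∧ InClosedCell l σ v := by
    intro σ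
    by_cases h : ∃ v ∈ X, v ≠ 0 ∧ InClosedCell l σ v
    · obtain ⟨v, hv⟩ := h
      exact ⟨v, fun _ => hv⟩
    · exact ⟨0, fun h' => absurd h' h⟩
  choose bot hbot using hbot
  obtain ⟨S, hScard, hS⟩ := exists_triangulation_flat l hl0 X bot (by
    intro T hT w hw hgen
    apply hbot
    obtain ⟨v, hv0, hv, T', hT', hvT'⟩ := exists_vertex l hl0 (finrank ℝ (flat l T) - 1) T
      (by omega) w hw hgen
    rw [hflat] at hT' hvT'
    obtain ⟨v', hv'X, c, hc, rfl⟩ := hX _ (by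
      intro h hh
      obtain ⟨i, -, rfl⟩ := Finset.mem_image.1 hh
      exact Finset.union_subset_union_left hRH i.2) hT' v hvT' hv0
    refine ⟨v', hv'X, fun h => hv0 (by simp [h]), fun i => ?_⟩
    simpa [sign_mul, sign_pos hc, hc.ne'] using hv i) D ∅ (by
      rw [flat, Finset.inf_empty, finrank_top, hV])
  let F₀ : Finset (Finset V) := (S.image Prod.snd).filter fun τ =>
    τ.card ≤ D + 1 ∧ τ ⊆ X ∧ ∀ h ∈ R, ∀ v ∈ τ, ∀ v' ∈ τ, ¬ sep (v, v') h
  have hcell : ∀ p : V, ∃ τ' ∈ F₀.biUnion Finset.powerset, ∃ c : V → ℝ, (∀ v ∈ τ', 0 < c v) ∧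
      ∑ v ∈ τ', c v • v = p := by
    intro p
    obtain ⟨w, -, hsign, hgen⟩ := exists_generic_perturbation l ⊤ (x := p) Submodule.mem_top
    obtain ⟨τ, hτS, hτp, hτcard, hτX, hτcell⟩ := hS w (by simp [flat])
      (fun i hi => le_top.trans (hgen i hi)) p (by
        intro i
        rcases lt_trichotomy (l i p) 0 with h | h | h
        · exact Or.inr (by rw [signVector, sign_neg h, sign_neg ((hsign i).2 h)])
        · exact Or.inl h
        · exact Or.inr (by rw [signVector, sign_pos h, sign_pos ((hsign i).1 h)]))
    obtain ⟨c, -, hc⟩ := Submodule.mem_span_finset.1 hτp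
    refine ⟨τ.filter fun v => c v ≠ 0, Finset.mem_biUnion.2 ⟨τ, ?_,
      Finset.mem_powerset.2 (Finset.filter_subset _ _)⟩, fun v => c v, fun v hv => ?_, ?_⟩
    · refine Finset.mem_filter.2 ⟨Finset.mem_image.2 ⟨_, hτS, rfl⟩, hτcard,
        Finset.coe_subset.1 hτX, fun h hh v hv v' hv' ⟨h1, h2⟩ => ?_⟩
      have hi : l ⟨h, Finset.mem_union_left _ hh⟩ = φ h := rfl
      have h3 := hτcell v hv ⟨h, Finset.mem_union_left _ hh⟩
      have h4 := hτcell v' hv' ⟨h, Finset.mem_union_left _ hh⟩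
      rw [hi] at h3 h4
      have h5 := (h3.resolve_left h1.ne).trans (h4.resolve_left h2.ne').symm
      rw [sign_neg h1, sign_pos h2] at h5
      exact absurd h5 (by decide)
    · exact_mod_cast pos_iff_ne_zero.2 (Finset.mem_filter.1 hv).2
    · rw [← hc]
      rw [Finset.sum_filter]
      refine Finset.sum_congr rfl fun v _ => ?_
      by_cases h : c v = 0
      · simp [h]
      · simp [h, NNReal.smul_def]
  choose cell hcellF c hc hcsum using hcell
  refine ⟨cell, F₀.biUnion Finset.powerset, hcellF, ?_, ?_⟩
  · refine (Finset.card_biUnion_le_card_mul _ _ (2 ^ (D + 1)) ?_).trans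
      (Nat.mul_le_mul_right _ ?_)
    · intro τ hτ
      rw [Finset.card_powerset]
      exact Nat.pow_le_pow_right (by norm_num) (Finset.mem_filter.1 hτ).2.1
    · refine (Finset.card_filter_le _ _).trans (Finset.card_image_le.trans (hScard.trans ?_))
      refine Nat.mul_le_mul_left _ (Nat.pow_le_pow_left (Nat.mul_le_mul_left _ ?_) _)
      rw [Fintype.card_coe]
      exact (Finset.card_union_le _ _).trans (by omega)
  · intro τ hτ H' hH' hcross
    obtain ⟨τ₀, hτ₀, hττ₀⟩ := Finset.mem_biUnion.1 hτ
    rw [Finset.mem_powerset] at hττ₀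
    obtain ⟨-, hτ₀card, hτ₀X, hτ₀sep⟩ := Finset.mem_filter.1 hτ₀
    have hsub : H' ⊆ (τ ×ˢ τ).biUnion fun u => H.filter (sep u) := by
      intro h hh
      obtain ⟨p, q, hp, hq, hph, hqh⟩ := hcross h hh
      rw [← hφ h (hHD h (hH' hh)), LinearMap.mem_ker] at hph hqh
      have hφp : ∑ v ∈ τ, c p v * φ h v = 0 := by
        have := congrArg (φ h) (hcsum p)
        rw [map_sum, hp, hph] at this
        simpa using this
      have hφq : ∑ v ∈ τ, c q v * φ h v ≠ 0 := by
        intro h0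
        apply hqh
        rw [← hcsum q, map_sum, hq]
        simpa using h0
      have hcp : ∀ v ∈ τ, 0 < c p v := fun v hv => hc p v (hp ▸ hv)
      have hall : ¬ ∀ v ∈ τ, φ h v = 0 := fun hall =>
        hφq (Finset.sum_eq_zero fun v hv => by rw [hall v hv, mul_zero])
      obtain ⟨v, hv, hvneg⟩ : ∃ v ∈ τ, φ h v < 0 := by
        by_contra! hnn
        refine hall fun v hv => ?_
        have := (Finset.sum_eq_zero_iff_of_nonneg fun v hv =>
          mul_nonneg (hcp v hv).le (hnn v hv)).1 hφp v hv
        exact (mul_eq_zero.1 this).resolve_left (hcp v hv).ne'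
      obtain ⟨v', hv', hvpos⟩ : ∃ v ∈ τ, 0 < φ h v := by
        by_contra! hnn
        refine hall fun v hv => ?_
        have := (Finset.sum_eq_zero_iff_of_nonpos fun v hv =>
          mul_nonpos_of_nonneg_of_nonpos (hcp v hv).le (hnn v hv)).1 hφp v hv
        exact (mul_eq_zero.1 this).resolve_left (hcp v hv).ne'
      exact Finset.mem_biUnion.2 ⟨(v, v'), Finset.mem_product.2 ⟨hv, hv'⟩,
        Finset.mem_filter.2 ⟨hH' hh, hvneg, hvpos⟩⟩
    have hpair : ∀ u ∈ τ ×ˢ τ, ((H.filter (sep u)).card : ℝ) ≤ x * H.card := by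
      intro u hu
      obtain ⟨hu1, hu2⟩ := Finset.mem_product.1 hu
      by_contra! hlt
      obtain ⟨h, hh, hsep'⟩ := hRU u (Finset.mem_filter.2 ⟨Finset.mem_product.2
        ⟨hτ₀X (hττ₀ hu1), hτ₀X (hττ₀ hu2)⟩, hlt.le⟩)
      exact hτ₀sep h hh u.1 (hττ₀ hu1) u.2 (hττ₀ hu2) hsep'
    have hτcard : τ.card ≤ D + 1 := (Finset.card_le_card hττ₀).trans hτ₀card
    calc (H'.card : ℝ) ≤ ∑ u ∈ τ ×ˢ τ, ((H.filter (sep u)).card : ℝ) := by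
          exact_mod_cast (Finset.card_le_card hsub).trans Finset.card_biUnion_le
      _ ≤ (τ ×ˢ τ).card • (x * H.card) := Finset.sum_le_card_nsmul _ _ _ hpair
      _ = (τ.card : ℝ) ^ 2 * (x * H.card) := by
          rw [nsmul_eq_mul, Finset.card_product]
          push_cast
          ring
      _ ≤ (D + 1) ^ 2 * (x * H.card) := by
          have : (τ.card : ℝ) ≤ D + 1 := by exact_mod_cast hτcard
          gcongr

end Hyperplanes

section Counting

open scoped Classical in
/-- The number of incidences between points and subspaces. -/
noncomputable def incidences {V : Type*} [AddCommGroup V] [Module ℝ V] (Q : Finset V)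
    (H : Finset (Submodule ℝ V)) : ℕ := ∑ q ∈ Q, (H.filter fun h => q ∈ h).card

open scoped Classical in
/-- Any two distinct points lie in fewer than `t` common members of `H`. -/
def FewCommon {V : Type*} [AddCommGroup V] [Module ℝ V] (t : ℕ) (Q : Finset V)
    (H : Finset (Submodule ℝ V)) : Prop :=
  ∀ q ∈ Q, ∀ q' ∈ Q, q ≠ q' → (H.filter fun h => q ∈ h ∧ q' ∈ h).card < t

variable {V : Type*} [AddCommGroup V] [Module ℝ V] {t : ℕ} {Q : Finset V}
  {H : Finset (Submodule ℝ V)}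

open scoped Classical in
lemma FewCommon.mono {Q' : Finset V} {H' : Finset (Submodule ℝ V)} (h : FewCommon t Q H)
    (hQ : Q' ⊆ Q) (hH : H' ⊆ H) : FewCommon t Q' H' := fun q hq q' hq' hne =>
  (Finset.card_le_card (Finset.filter_subset_filter _ hH)).trans_lt
    (h q (hQ hq) q' (hQ hq') hne)

open scoped Classical in
lemma incidences_le_mul (Q : Finset V) (H : Finset (Submodule ℝ V)) :
    incidences Q H ≤ Q.card * H.card := by
  rw [incidences, ← smul_eq_mul]
  exact Finset.sum_le_card_nsmul _ _ _ fun q _ => Finset.card_filter_le _ _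

lemma incidences_filter_add_filter_not (p : V → Prop) [DecidablePred p] :
    incidences (Q.filter p) H + incidences (Q.filter fun q => ¬ p q) H = incidences Q H :=
  Finset.sum_filter_add_sum_filter_not _ _ _

open scoped Classical in
/-- The Kővári–Sós–Turán bound. -/
lemma incidences_le_card_add (h : FewCommon t Q H) :
    incidences Q H ≤ H.card + t * Q.card ^ 2 := by
  have h1 : incidences Q H = ∑ a ∈ H, (Q.filter fun q => q ∈ a).card :=
    Finset.sum_card_bipartiteAbove_eq_sum_card_bipartiteBelow
      (fun (q : V) (a : Submodule ℝ V) => q ∈ a)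
  have h2 : ∑ a ∈ H, ((Q.filter fun q => q ∈ a).offDiag).card =
      ∑ u ∈ Q.offDiag, (H.filter fun a => u.1 ∈ a ∧ u.2 ∈ a).card := by
    refine Eq.trans (Finset.sum_congr rfl fun a _ => congrArg _ ?_)
      (Finset.sum_card_bipartiteAbove_eq_sum_card_bipartiteBelow
        (fun (u : V × V) (a : Submodule ℝ V) => u.1 ∈ a ∧ u.2 ∈ a) (s := Q.offDiag) (t := H)).symm
    ext u
    simp only [Finset.mem_offDiag, Finset.mem_filter, Finset.mem_bipartiteBelow]
    tauto
  have h3 : ∑ u ∈ Q.offDiag, (H.filter fun a => u.1 ∈ a ∧ u.2 ∈ a).card ≤ Q.card ^ 2 * t := by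
    refine (Finset.sum_le_card_nsmul _ _ t fun u hu => ?_).trans ?_
    · obtain ⟨hu1, hu2, hne⟩ := Finset.mem_offDiag.1 hu
      convert (h u.1 hu1 u.2 hu2 hne).le
    · rw [smul_eq_mul, Finset.offDiag_card, sq]
      exact Nat.mul_le_mul_right _ (Nat.sub_le _ _)
  have h4 : ∀ a ∈ H, (Q.filter fun q => q ∈ a).card ≤
      1 + ((Q.filter fun q => q ∈ a).offDiag).card := by
    intro a _
    rw [Finset.offDiag_card]
    generalize (Q.filter fun q => q ∈ a).card = k
    rcases k with _ | _ | k
    · omega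
    · omega
    · have : (k + 1 + 1) * (k + 1 + 1) = (k + 1 + 1) + (k + 1 + 1) * (k + 1) := by ring
      rw [this, Nat.add_sub_cancel_left]
      nlinarith
  rw [h1]
  refine (Finset.sum_le_sum h4).trans ?_
  rw [Finset.sum_add_distrib, h2, Finset.sum_const, smul_eq_mul, mul_one]
  linarith

open scoped Classical in
/-- There are few points of degree at least `t`. -/
lemma card_le_pow_of_rich [FiniteDimensional ℝ V] {D : ℕ}
    (ht : 1 ≤ t) (hHD : ∀ h ∈ H, finrank ℝ h = D) (h0 : ∀ q ∈ Q, q ≠ 0) (h : FewCommon t Q H)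
    (hrich : ∀ q ∈ Q, t ≤ (H.filter fun h => q ∈ h).card) : Q.card ≤ H.card ^ D := by
  have hex : ∀ q : V, ∃ g : Fin D → Submodule ℝ V, q ∈ Q →
      (∀ i, g i ∈ H) ∧ ⨅ i, g i = (H.filter fun h => q ∈ h).inf id := by
    intro q
    by_cases hq : q ∈ Q
    · have hne : (H.filter fun h => q ∈ h).Nonempty :=
        Finset.card_pos.1 (lt_of_lt_of_le ht (hrich q hq))
      have hmem : q ∈ (H.filter fun h => q ∈ h).inf id := by
        rw [Submodule.mem_finsetInf]
        exact fun i hi => (Finset.mem_filter.1 hi).2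
      have hpos : 0 < finrank ℝ ↥((H.filter fun h => q ∈ h).inf id) :=
        Module.finrank_pos_iff_exists_ne_zero.2 ⟨⟨q, hmem⟩, fun h' =>
          h0 q hq (congrArg Subtype.val h')⟩
      obtain ⟨g, hg, hg'⟩ := exists_iInf_fin_eq hne
        (fun h hh => hHD h (Finset.mem_filter.1 hh).1) hpos
      exact ⟨g, fun _ => ⟨fun i => (Finset.mem_filter.1 (hg i)).1, hg'⟩⟩
    · exact ⟨fun _ => ⊥, fun h' => absurd h' hq⟩
  choose g hg using hex
  have hcard : (Fintype.piFinset fun _ : Fin D => H).card = H.card ^ D :=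
    Fintype.card_piFinset_const _ _
  rw [← hcard]
  refine Finset.card_le_card_of_injOn g (fun q hq => Finset.mem_coe.2
    (Fintype.mem_piFinset.2 (hg q hq).1)) fun q hq q' hq' heq => ?_
  by_contra hne
  have hinf : (H.filter fun h => q ∈ h).inf id = (H.filter fun h => q' ∈ h).inf id := by
    rw [← (hg q hq).2, ← (hg q' hq').2, heq]
  refine absurd (h q hq q' hq' hne) (not_lt.2 ((hrich q hq).trans (Finset.card_le_card ?_)))
  intro a ha
  refine Finset.mem_filter.2 ⟨(Finset.mem_filter.1 ha).1, (Finset.mem_filter.1 ha).2, ?_⟩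
  have hmem : q' ∈ (H.filter fun h => q' ∈ h).inf id := by
    rw [Submodule.mem_finsetInf]
    exact fun i hi => (Finset.mem_filter.1 hi).2
  rw [← hinf] at hmem
  exact Submodule.mem_finsetInf.1 hmem a ha

open scoped Classical in
/-- Splitting the incidences according to a partition of space into cells. -/
lemma incidences_le_sum_cells {κ : Type*} [DecidableEq κ] (h : FewCommon t Q H) (cell : V → κ)
    (F : Finset κ) (hF : ∀ p, cell p ∈ F) :
    incidences Q H ≤ ∑ τ ∈ F, incidences (Q.filter fun q => cell q = τ)
      (H.filter fun a => ∃ p q, cell p = τ ∧ cell q = τ ∧ p ∈ a ∧ q ∉ a) +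
      t * Q.card + F.card * H.card := by
  have hsum : incidences Q H = ∑ τ ∈ F, incidences (Q.filter fun q => cell q = τ) H :=
    (Finset.sum_fiberwise_of_maps_to (fun q _ => hF q) _).symm
  have hcardQ : Q.card = ∑ τ ∈ F, (Q.filter fun q => cell q = τ).card :=
    Finset.card_eq_sum_card_fiberwise fun q _ => hF q
  have hterm : ∀ τ ∈ F, incidences (Q.filter fun q => cell q = τ) H ≤
      incidences (Q.filter fun q => cell q = τ)
        (H.filter fun a => ∃ p q, cell p = τ ∧ cell q = τ ∧ p ∈ a ∧ q ∉ a) +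
        t * (Q.filter fun q => cell q = τ).card + H.card := by
    intro τ _
    set Qτ := Q.filter fun q => cell q = τ with hQτ
    rcases le_or_gt Qτ.card 1 with hle | hgt
    · calc incidences Qτ H ≤ Qτ.card * H.card := incidences_le_mul _ _
        _ ≤ 1 * H.card := Nat.mul_le_mul_right _ hle
        _ ≤ _ := by omega
    · have hdeg : ∀ q ∈ Qτ, (H.filter fun a => q ∈ a).card ≤
          ((H.filter fun a => ∃ p q, cell p = τ ∧ cell q = τ ∧ p ∈ a ∧ q ∉ a).filter
            fun a => q ∈ a).card + t := by
        intro q hq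
        obtain ⟨q', hq', hne⟩ := Finset.exists_mem_ne hgt q
        have hlt := h q (Finset.mem_filter.1 hq).1 q' (Finset.mem_filter.1 hq').1 hne.symm
        refine (Finset.card_le_card ?_).trans ((Finset.card_union_le _ _).trans
          (Nat.add_le_add_left hlt.le _))
        intro a ha
        obtain ⟨haH, hqa⟩ := Finset.mem_filter.1 ha
        rw [Finset.mem_union]
        by_cases hq'a : q' ∈ a
        · exact Or.inr (Finset.mem_filter.2 ⟨haH, hqa, hq'a⟩)
        · exact Or.inl (Finset.mem_filter.2 ⟨Finset.mem_filter.2 ⟨haH, q, q',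
            (Finset.mem_filter.1 hq).2, (Finset.mem_filter.1 hq').2, hqa, hq'a⟩, hqa⟩)
      refine (Finset.sum_le_sum hdeg).trans ?_
      rw [Finset.sum_add_distrib, Finset.sum_const, smul_eq_mul, mul_comm Qτ.card t]
      exact Nat.le_add_right _ _
  rw [hsum]
  refine (Finset.sum_le_sum hterm).trans (le_of_eq ?_)
  rw [Finset.sum_add_distrib, Finset.sum_add_distrib, ← Finset.mul_sum, ← hcardQ,
    Finset.sum_const, smul_eq_mul]

end Counting

/-- A form of Hölder's inequality for powers with exponent at most one. -/
lemma sum_rpow_le {κ : Type*} (F : Finset κ) (f : κ → ℝ) (hf : ∀ τ ∈ F, 0 ≤ f τ) {a : ℝ}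
    (ha : 0 < a) (ha1 : a ≤ 1) :
    ∑ τ ∈ F, f τ ^ a ≤ (F.card : ℝ) ^ (1 - a) * (∑ τ ∈ F, f τ) ^ a := by
  have h1 : (∑ τ ∈ F, f τ ^ a) ^ a⁻¹ ≤ (F.card : ℝ) ^ (a⁻¹ - 1) * ∑ τ ∈ F, f τ := by
    refine (Real.rpow_sum_le_const_mul_sum_rpow_of_nonneg (p := a⁻¹) F
      (one_le_inv₀ ha |>.2 ha1) fun τ hτ => Real.rpow_nonneg (hf τ hτ) a).trans (le_of_eq ?_)
    congr 1
    exact Finset.sum_congr rfl fun τ hτ => Real.rpow_rpow_inv (hf τ hτ) ha.ne'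
  have h0 : 0 ≤ ∑ τ ∈ F, f τ ^ a := Finset.sum_nonneg fun τ hτ => Real.rpow_nonneg (hf τ hτ) a
  calc ∑ τ ∈ F, f τ ^ a = ((∑ τ ∈ F, f τ ^ a) ^ a⁻¹) ^ a := (Real.rpow_inv_rpow h0 ha.ne').symm
    _ ≤ ((F.card : ℝ) ^ (a⁻¹ - 1) * ∑ τ ∈ F, f τ) ^ a :=
      Real.rpow_le_rpow (Real.rpow_nonneg h0 _) h1 ha.le
    _ = _ := by
      rw [Real.mul_rpow (by positivity) (Finset.sum_nonneg hf), ← Real.rpow_mul (by positivity)]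
      congr 2
      field_simp

/-- Choice of the parameters of the cutting: with `s` sampled hyperplanes and crossing proportion
`x`, both the number of cells and the loss in the recursion are controlled. -/
lemma exists_cutting_parameters (D : ℕ) (hD : 2 ≤ D) (ε : ℝ) (hε : 0 < ε) (hε1 : ε ≤ 1)
    (a β : ℝ) (ha : a ≤ 1) (hβ0 : 0 < β) (hβ1 : β ≤ 1) (hab : D * (1 - a) = β - D * ε) :
    ∃ m₀ : ℕ, 1 ≤ m₀ ∧ ∀ m : ℕ, m₀ ≤ m → ∃ (s : ℕ) (x : ℝ), 0 ≤ x ∧ x ≤ 1 ∧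
      ((2 * (m + D + 1) ^ D) ^ 2 : ℝ) * (1 - x) ^ s < 1 ∧
      (D + 1) ^ 2 * x < 1 ∧
      (2 * (2 * (s + D + 1)) ^ D * 2 ^ (D + 1) : ℝ) ≤ (m : ℝ) ^ (ε / 2) ∧
      (2 * (2 * (s + D + 1)) ^ D * 2 ^ (D + 1) : ℝ) ^ (1 - a) * ((D + 1) ^ 2 * x) ^ β ≤ 1 / 2 := by
  have hDpos : (2 : ℝ) ≤ D := by exact_mod_cast hD
  set δ : ℝ := ε / (8 * D) with hδ
  have hδ0 : 0 < δ := by positivity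
  have hδD : δ * D = ε / 8 := by rw [hδ]; field_simp
  set η : ℝ := δ * ε with hη
  have hη0 : 0 < η := by positivity
  have hηδ : η ≤ δ := by rw [hη]; nlinarith
  set c : ℝ := 2 * (2 * (D + 3)) ^ D * 2 ^ (D + 1) with hc
  have hc0 : 0 < c := by positivity
  have hlim1 : Filter.Tendsto
      (fun u : ℝ => (2 * ((D : ℝ) + 2) ^ D) ^ 2 * ((u ^ η) ^ (2 * D / η) * Real.exp (-1 * u ^ η)))
      Filter.atTop (nhds 0) := by
    have := ((tendsto_rpow_mul_exp_neg_mul_atTop_nhds_zero (2 * D / η) 1 one_pos).comp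
      (tendsto_rpow_atTop hη0)).const_mul ((2 * ((D : ℝ) + 2) ^ D) ^ 2)
    rwa [mul_zero] at this
  have hneg : ∀ (C κ : ℝ), 0 < κ → Filter.Tendsto (fun u : ℝ => C * u ^ (-κ))
      Filter.atTop (nhds 0) := fun C κ hκ => by
    have := (tendsto_rpow_neg_atTop hκ).const_mul C
    rwa [mul_zero] at this
  have hκ2 : 0 < ε / 2 - (δ + η) * D := by nlinarith
  have hκ3 : 0 < δ * β - (δ + η) * D * (1 - a) := by
    rw [mul_assoc, hab]
    have : δ * β - (δ + η) * (β - D * ε) = δ * D * ε + η * D * ε - η * β := by ring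
    rw [this]
    have h1 : η * β ≤ η := by nlinarith
    have h2 : δ * D * ε = η * D := by rw [hη]; ring
    have h3 : 0 < η * D * ε := by positivity
    nlinarith
  have hev := ((((hlim1.eventually (gt_mem_nhds one_pos)).and
    ((hneg ((D + 1) ^ 2) δ hδ0).eventually (gt_mem_nhds one_pos))).and
    ((hneg c _ hκ2).eventually (gt_mem_nhds one_pos))).and
    ((hneg (c ^ (1 - a) * ((D + 1) ^ 2) ^ β) _ hκ3).eventually (gt_mem_nhds one_half_pos))).and
    (Filter.eventually_ge_atTop 1)
  obtain ⟨M, hM⟩ := Filter.eventually_atTop.1 hev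
  refine ⟨max ⌈M⌉₊ 1, le_max_right _ _, fun m hm => ?_⟩
  obtain ⟨⟨⟨⟨h1, h2⟩, h3⟩, h4⟩, hm1⟩ := hM m (Nat.ceil_le.1 ((le_max_left _ _).trans hm))
  have hm0 : (0 : ℝ) < m := by linarith
  set u : ℝ := (m : ℝ) with hu
  have hx1 : u ^ (-δ) ≤ 1 := Real.rpow_le_one_of_one_le_of_nonpos hm1 (by linarith)
  have hx0 : 0 < u ^ (-δ) := Real.rpow_pos_of_pos hm0 _
  set s : ℕ := ⌈u ^ (δ + η)⌉₊ with hs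
  have hsle : u ^ (δ + η) ≤ s := Nat.le_ceil _
  have hu1 : 1 ≤ u ^ (δ + η) := Real.one_le_rpow hm1 (by positivity)
  have hslt : (s : ℝ) < u ^ (δ + η) + 1 := Nat.ceil_lt_add_one (by positivity)
  have hK : (2 * (2 * (s + D + 1)) ^ D * 2 ^ (D + 1) : ℝ) ≤ c * u ^ ((δ + η) * D) := by
    have h5 : (s + D + 1 : ℝ) ≤ (D + 3) * u ^ (δ + η) := by nlinarith
    calc (2 * (2 * (s + D + 1)) ^ D * 2 ^ (D + 1) : ℝ)
        ≤ 2 * (2 * ((D + 3) * u ^ (δ + η))) ^ D * 2 ^ (D + 1) := by gcongr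
      _ = _ := by
        rw [Real.rpow_mul_natCast hm0.le, hc, ← mul_assoc 2 _ (u ^ (δ + η)), mul_pow]
        ring
  refine ⟨s, u ^ (-δ), hx0.le, hx1, ?_, h2, ?_, ?_⟩
  · have h5 : (1 - u ^ (-δ)) ^ s ≤ Real.exp (-1 * u ^ η) := by
      calc (1 - u ^ (-δ)) ^ s ≤ Real.exp (-u ^ (-δ)) ^ s := by
            refine pow_le_pow_left₀ (by linarith) ?_ _
            linarith [Real.add_one_le_exp (-u ^ (-δ))]
        _ = Real.exp (-(s * u ^ (-δ))) := by rw [← Real.exp_nat_mul]; ring_nf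
        _ ≤ Real.exp (-1 * u ^ η) := by
            refine Real.exp_le_exp.2 ?_
            have : u ^ η = u ^ (δ + η) * u ^ (-δ) := by rw [← Real.rpow_add hm0]; ring_nf
            rw [this, neg_one_mul, neg_le_neg_iff]
            exact mul_le_mul_of_nonneg_right hsle hx0.le
    have h6 : (u ^ η) ^ (2 * D / η) = (u ^ D) ^ 2 := by
      rw [← Real.rpow_mul hm0.le, ← pow_mul, ← Real.rpow_natCast]
      congr 1
      push_cast
      field_simp
    rw [h6] at h1
    refine lt_of_le_of_lt ?_ h1
    have h7 : (u + D + 1 : ℝ) ≤ (D + 2) * u := by nlinarith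
    calc (2 * (u + D + 1) ^ D) ^ 2 * (1 - u ^ (-δ)) ^ s
        ≤ (2 * ((D + 2) * u) ^ D) ^ 2 * Real.exp (-1 * u ^ η) := by
          have : 0 ≤ 1 - u ^ (-δ) := by linarith
          gcongr
      _ = _ := by rw [mul_pow (D + 2 : ℝ) u D]; ring
  · refine hK.trans ?_
    have h5 : u ^ ((δ + η) * D) = u ^ (ε / 2) * u ^ (-(ε / 2 - (δ + η) * D)) := by
      rw [← Real.rpow_add hm0]; ring_nf
    calc c * u ^ ((δ + η) * D) = u ^ (ε / 2) * (c * u ^ (-(ε / 2 - (δ + η) * D))) := by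
          rw [h5]; ring
      _ ≤ u ^ (ε / 2) * 1 := by gcongr
      _ = _ := mul_one _
  · calc (2 * (2 * (s + D + 1)) ^ D * 2 ^ (D + 1) : ℝ) ^ (1 - a) * ((D + 1) ^ 2 * u ^ (-δ)) ^ β
        ≤ (c * u ^ ((δ + η) * D)) ^ (1 - a) * ((D + 1) ^ 2 * u ^ (-δ)) ^ β := by
          have : 0 ≤ 1 - a := by linarith
          gcongr
      _ = c ^ (1 - a) * ((D + 1) ^ 2) ^ β * u ^ (-(δ * β - (δ + η) * D * (1 - a))) := by
          rw [Real.mul_rpow hc0.le (by positivity), Real.mul_rpow (by positivity) hx0.le,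
            ← Real.rpow_mul hm0.le, ← Real.rpow_mul hm0.le]
          have : u ^ (-(δ * β - (δ + η) * D * (1 - a))) =
              u ^ ((δ + η) * D * (1 - a)) * u ^ (-δ * β) := by
            rw [← Real.rpow_add hm0]; ring_nf
          rw [this]
          ring
      _ ≤ 1 / 2 := h4.le

lemma le_rpow_mul_rpow {n m a β : ℝ} {D : ℕ} (hn : 1 ≤ n) (hm : 1 ≤ m) (hnm : n ≤ m ^ D)
    (ha : a ≤ 1) (hβ : D * (1 - a) ≤ β) : n ≤ n ^ a * m ^ β := by
  have hn0 : 0 < n := by linarith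
  have hm0 : 0 ≤ m := by linarith
  calc n = n ^ a * n ^ (1 - a) := by rw [← Real.rpow_add hn0, add_sub_cancel, Real.rpow_one]
    _ ≤ n ^ a * (m ^ D) ^ (1 - a) := by
      have : 0 ≤ 1 - a := by linarith
      gcongr
    _ = n ^ a * m ^ (D * (1 - a)) := by rw [Real.rpow_natCast_mul hm0]
    _ ≤ n ^ a * m ^ β := by
      gcongr

lemma rpow_mul_le_rpow_mul_rpow {n m a β γ : ℝ} (hn : 1 ≤ n) (hm : 1 ≤ m) (hmn : m ≤ n ^ 2)
    (hγ : 0 ≤ γ + 1 - β) (ha : 2 * (γ + 1 - β) ≤ a) : m ^ γ * m ≤ n ^ a * m ^ β := by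
  have hn0 : 0 ≤ n := by linarith
  have hm0 : 0 < m := by linarith
  calc m ^ γ * m = m ^ (γ + 1 - β) * m ^ β := by
        rw [← Real.rpow_add hm0, sub_add_cancel, Real.rpow_add hm0, Real.rpow_one]
    _ ≤ (n ^ 2) ^ (γ + 1 - β) * m ^ β := by gcongr
    _ = n ^ (2 * (γ + 1 - β)) * m ^ β := by
      rw [← Real.rpow_natCast_mul hn0, Nat.cast_ofNat]
    _ ≤ n ^ a * m ^ β := by
      gcongr

open scoped Classical in
/-- Points of low degree do not matter for a bound containing a term linear in the number of
points. -/
lemma incidences_le_of_rich {V : Type*} [AddCommGroup V] [Module ℝ V] {t : ℕ} {Q : Finset V}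
    {H : Finset (Submodule ℝ V)} {p : V → Prop} [DecidablePred p] {A : ℝ} (hA : (t : ℝ) ≤ A) {B : ℝ}
    (hp : ∀ q ∈ Q, ¬ p q → (H.filter fun h => q ∈ h).card ≤ t)
    (hB : (incidences (Q.filter p) H : ℝ) ≤ B + A * (H.card + (Q.filter p).card)) :
    (incidences Q H : ℝ) ≤ B + A * (H.card + Q.card) := by
  have hpoor : incidences (Q.filter fun q => ¬ p q) H ≤ t * (Q.filter fun q => ¬ p q).card := by
    rw [mul_comm, ← smul_eq_mul]
    exact Finset.sum_le_card_nsmul _ _ _ fun q hq =>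
      hp q (Finset.mem_filter.1 hq).1 (Finset.mem_filter.1 hq).2
  have hcard : ((Q.filter p).card : ℝ) + (Q.filter fun q => ¬ p q).card = Q.card := by
    exact_mod_cast Finset.card_filter_add_card_filter_not p
  have hpoor' : (incidences (Q.filter fun q => ¬ p q) H : ℝ) ≤
      A * (Q.filter fun q => ¬ p q).card :=
    (by exact_mod_cast hpoor : (incidences (Q.filter fun q => ¬ p q) H : ℝ) ≤
      t * (Q.filter fun q => ¬ p q).card).trans (by gcongr)
  rw [← incidences_filter_add_filter_not p, ← hcard]
  push_cast
  linarith

open scoped Classical in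
/-- Summation over the cells of incidence bounds inside the cells. -/
lemma incidences_le_of_cells {V κ : Type*} [AddCommGroup V] [Module ℝ V] [DecidableEq κ] {t : ℕ}
    {Q : Finset V} {H : Finset (Submodule ℝ V)} (h : FewCommon t Q H) (cell : V → κ)
    (F : Finset κ) (hF : ∀ p, cell p ∈ F) {a A B C K : ℝ} (ha0 : 0 < a) (ha1 : a ≤ 1)
    (hA : 0 ≤ A) (hFK : (F.card : ℝ) ≤ K)
    (hcell : ∀ τ ∈ F, (incidences (Q.filter fun q => cell q = τ)
      (H.filter fun a => ∃ p q, cell p = τ ∧ cell q = τ ∧ p ∈ a ∧ q ∉ a) : ℝ) ≤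
      A * ((Q.filter fun q => cell q = τ).card : ℝ) ^ a + B +
        C * (Q.filter fun q => cell q = τ).card) :
    (incidences Q H : ℝ) ≤ A * (K ^ (1 - a) * (Q.card : ℝ) ^ a) + F.card * B + C * Q.card +
      t * Q.card + F.card * H.card := by
  have hcard : ∑ τ ∈ F, ((Q.filter fun q => cell q = τ).card : ℝ) = Q.card := by
    exact_mod_cast (Finset.card_eq_sum_card_fiberwise fun q _ => hF q).symm
  have hholder : ∑ τ ∈ F, ((Q.filter fun q => cell q = τ).card : ℝ) ^ a ≤
      K ^ (1 - a) * (Q.card : ℝ) ^ a := by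
    refine (sum_rpow_le F _ (fun _ _ => Nat.cast_nonneg _) ha0 ha1).trans ?_
    rw [hcard]
    have : 0 ≤ 1 - a := by linarith
    gcongr
  have hsum : (incidences Q H : ℝ) ≤ ∑ τ ∈ F, (incidences (Q.filter fun q => cell q = τ)
      (H.filter fun a => ∃ p q, cell p = τ ∧ cell q = τ ∧ p ∈ a ∧ q ∉ a) : ℝ) +
      t * Q.card + F.card * H.card := by
    exact_mod_cast incidences_le_sum_cells h cell F hF
  refine hsum.trans ?_
  gcongr
  refine (Finset.sum_le_sum hcell).trans ?_
  rw [Finset.sum_add_distrib, Finset.sum_add_distrib, ← Finset.mul_sum, ← Finset.mul_sum,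
    Finset.sum_const, nsmul_eq_mul, hcard]
  gcongr

set_option maxHeartbeats 800000 in
open scoped Classical in
/-- Incidence bound for points and hyperplanes through the origin in a space of dimension
`D + 1`, by recursion on cuttings. -/
lemma exists_incidences_le {V : Type*} [AddCommGroup V] [Module ℝ V] [FiniteDimensional ℝ V]
    {D : ℕ} (hV : finrank ℝ V = D + 1) (hD : 2 ≤ D) {t : ℕ} (ht : 1 ≤ t) {ε a β : ℝ}
    (hε : 0 < ε) (hε1 : ε ≤ 1) (ha0 : 0 < a) (ha1 : a ≤ 1) (hβ0 : 0 < β) (hβ1 : β ≤ 1)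
    (hab : D * (1 - a) = β - D * ε) (hab' : a = 2 * (ε / 2 + 1 - β)) :
    ∃ C C' : ℝ, 0 < C ∧ 0 < C' ∧ ∀ (Q : Finset V) (H : Finset (Submodule ℝ V)),
      (∀ q ∈ Q, q ≠ 0) → (∀ h ∈ H, finrank ℝ h = D) → FewCommon t Q H →
      (incidences Q H : ℝ) ≤
        C * ((Q.card : ℝ) ^ a * (H.card : ℝ) ^ β) + C' * (H.card + Q.card) := by
  obtain ⟨m₀, hm₀1, hm₀⟩ := exists_cutting_parameters D hD ε hε hε1 a β ha1 hβ0 hβ1 hab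
  set C' : ℝ := m₀ + t + 1 with hC'
  have hC'0 : 0 < C' := by positivity
  set C : ℝ := 2 * (2 * C' + 1 + t) with hC
  have hC0 : 0 < C := by positivity
  refine ⟨C, C', hC0, hC'0, fun Q H => ?_⟩
  induction hk : H.card using Nat.strong_induction_on generalizing Q H with
  | _ m ih =>
  intro hQ0 hHD hfew
  rcases lt_or_ge m m₀ with hlt | hge
  · have h1 : (incidences Q H : ℝ) ≤ Q.card * m := by
      exact_mod_cast hk ▸ incidences_le_mul Q H
    have h2 : (m : ℝ) ≤ C' := by
      have : (m : ℝ) ≤ m₀ := by exact_mod_cast hlt.le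
      rw [hC']
      linarith [(Nat.cast_nonneg t : (0 : ℝ) ≤ t)]
    have h3 : (Q.card : ℝ) * m ≤ Q.card * C' := by gcongr
    have h4 : 0 ≤ C * ((Q.card : ℝ) ^ a * (m : ℝ) ^ β) := by positivity
    have h5 : 0 ≤ C' * m := by positivity
    linarith
  have htC' : (t : ℝ) ≤ C' := by
    rw [hC']
    linarith [(Nat.cast_nonneg m₀ : (0 : ℝ) ≤ m₀)]
  have hm1 : (1 : ℝ) ≤ m := by exact_mod_cast hm₀1.trans hge
  subst hk
  refine incidences_le_of_rich (p := fun q => t ≤ (H.filter fun h => q ∈ h).card) htC'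
    (fun q _ hq => (not_le.1 hq).le) ?_
  set Q₁ := Q.filter fun q => t ≤ (H.filter fun h => q ∈ h).card with hQ₁
  have hsub : Q₁ ⊆ Q := Finset.filter_subset _ _
  refine (?_ : (incidences Q₁ H : ℝ) ≤
    C * ((Q₁.card : ℝ) ^ a * (H.card : ℝ) ^ β) + C' * (H.card + Q₁.card)).trans
    (by gcongr)
  have hfew₁ : FewCommon t Q₁ H := hfew.mono hsub subset_rfl
  rcases le_or_gt (Q₁.card ^ 2) H.card with hle | hgt
  · have h1 : (incidences Q₁ H : ℝ) ≤ H.card + t * (Q₁.card : ℝ) ^ 2 := by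
      exact_mod_cast incidences_le_card_add hfew₁
    have h2 : (t : ℝ) * (Q₁.card : ℝ) ^ 2 ≤ t * H.card := by
      gcongr
      exact_mod_cast hle
    have h3 : ((1 : ℝ) + t) * H.card ≤ C' * H.card := by
      gcongr
      rw [hC']
      linarith [(Nat.cast_nonneg m₀ : (0 : ℝ) ≤ m₀)]
    have h4 : 0 ≤ C * ((Q₁.card : ℝ) ^ a * (H.card : ℝ) ^ β) := by positivity
    have h5 : 0 ≤ C' * Q₁.card := by positivity
    linarith
  have hn1 : (1 : ℝ) ≤ Q₁.card := by
    have : Q₁.card ≠ 0 := fun h => by simp [h] at hgt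
    exact_mod_cast Nat.one_le_iff_ne_zero.2 this
  have hrich : (Q₁.card : ℝ) ≤ (H.card : ℝ) ^ D := by
    exact_mod_cast card_le_pow_of_rich ht hHD (fun q hq => hQ0 q (hsub hq)) hfew₁
      fun q hq => (Finset.mem_filter.1 hq).2
  obtain ⟨s, x, hx0, hx1, hs, hy1, hK, hKy⟩ := hm₀ H.card hge
  obtain ⟨cell, F, hF, hFcard, hcross⟩ := exists_cutting hV (by omega) H
    (Finset.card_pos.1 (hm₀1.trans hge)) hHD s x hx0 hx1 hs
  set y : ℝ := (D + 1) ^ 2 * x with hy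
  have hy0 : 0 ≤ y := by positivity
  set K : ℝ := 2 * (2 * (s + D + 1)) ^ D * 2 ^ (D + 1) with hKdef
  have hFK : (F.card : ℝ) ≤ K := by
    rw [hKdef]
    exact_mod_cast hFcard
  set P : ℝ := (Q₁.card : ℝ) ^ a * (H.card : ℝ) ^ β with hP
  have hP0 : 0 ≤ P := by positivity
  have hnP : (Q₁.card : ℝ) ≤ P :=
    le_rpow_mul_rpow hn1 hm1 hrich ha1 (by rw [hab]; nlinarith [(Nat.cast_nonneg D : (0 : ℝ) ≤ D)])
  have hmP : K * H.card ≤ P :=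
    (mul_le_mul_of_nonneg_right hK (Nat.cast_nonneg _)).trans
      (rpow_mul_le_rpow_mul_rpow hn1 hm1 (by exact_mod_cast hgt.le) (by linarith) hab'.ge)
  have hcell : ∀ τ ∈ F, (incidences (Q₁.filter fun q => cell q = τ)
      (H.filter fun h => ∃ p q, cell p = τ ∧ cell q = τ ∧ p ∈ h ∧ q ∉ h) : ℝ) ≤
      C * (y ^ β * (H.card : ℝ) ^ β) * ((Q₁.filter fun q => cell q = τ).card : ℝ) ^ a +
        C' * H.card + C' * (Q₁.filter fun q => cell q = τ).card := by
    intro τ hτ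
    set H' := H.filter fun h => ∃ p q, cell p = τ ∧ cell q = τ ∧ p ∈ h ∧ q ∉ h with hH'
    have hH'sub : H' ⊆ H := Finset.filter_subset _ _
    have hH'le : (H'.card : ℝ) ≤ y * H.card := by
      rw [hy, mul_assoc]
      exact hcross τ hτ H' hH'sub fun h hh => (Finset.mem_filter.1 hh).2
    have hH'lt : (H'.card : ℝ) < H.card := hH'le.trans_lt (by nlinarith)
    have hQ'sub : (Q₁.filter fun q => cell q = τ) ⊆ Q₁ := Finset.filter_subset _ _
    refine (ih H'.card (by exact_mod_cast hH'lt) _ H' rfl (fun q hq => hQ0 q (hsub (hQ'sub hq)))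
      (fun h hh => hHD h (hH'sub hh)) (hfew₁.mono hQ'sub hH'sub)).trans ?_
    have h1 : (H'.card : ℝ) ^ β ≤ y ^ β * (H.card : ℝ) ^ β := by
      rw [← Real.mul_rpow hy0 (Nat.cast_nonneg _)]
      gcongr
    rw [mul_add, mul_comm (_ ^ a) (_ ^ β), ← mul_assoc, ← add_assoc]
    gcongr
  have hsum := incidences_le_of_cells hfew₁ cell F hF ha0 ha1 (by positivity) hFK hcell
  have hmain : C * (y ^ β * (H.card : ℝ) ^ β) * (K ^ (1 - a) * (Q₁.card : ℝ) ^ a) ≤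
      C / 2 * P := by
    calc C * (y ^ β * (H.card : ℝ) ^ β) * (K ^ (1 - a) * (Q₁.card : ℝ) ^ a)
        = C * (K ^ (1 - a) * y ^ β) * P := by rw [hP]; ring
      _ ≤ C * (1 / 2) * P := by gcongr
      _ = C / 2 * P := by ring
  have hFm : (F.card : ℝ) * H.card ≤ P := (mul_le_mul_of_nonneg_right hFK (by positivity)).trans hmP
  have h1 : (F.card : ℝ) * (C' * H.card) ≤ C' * P := by
    rw [mul_left_comm]
    gcongr
  have h2 : (t : ℝ) * Q₁.card ≤ t * P := by gcongr
  have h3 : C' * (Q₁.card : ℝ) ≤ C' * P := by gcongr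
  have h4 : 0 ≤ C' * (H.card + Q₁.card : ℝ) := by positivity
  have h5 : C * P = C / 2 * P + (C' * P + C' * P + P + t * P) := by rw [hC]; ring
  linarith

open scoped Classical in
lemma ncard_incidences_eq {V : Type*} [AddCommGroup V] [Module ℝ V] (Q : Finset V)
    (H : Finset (Submodule ℝ V)) :
    Set.ncard {x : V × Submodule ℝ V | x.1 ∈ Q ∧ x.2 ∈ H ∧ x.1 ∈ x.2} = incidences Q H := by
  have h : {x : V × Submodule ℝ V | x.1 ∈ Q ∧ x.2 ∈ H ∧ x.1 ∈ x.2} =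
      ((Q ×ˢ H).filter fun x => x.1 ∈ x.2 : Finset (V × Submodule ℝ V)) := by
    ext x
    simp [and_assoc]
  rw [h, Set.ncard_coe_finset, incidences, Finset.card_filter, Finset.sum_product]
  exact Finset.sum_congr rfl fun q _ => (Finset.card_filter _ _).symm

end HyperplaneIncidence

/-- Incidence bound for points in `ℝ^d` (nonzero, pairwise non-proportional) and
hyperplanes through the origin, assuming no `K_{2,t}` in the incidence graph. -/
theorem points_linear_hyperplanes_incidences (d t : ℕ) (hd : 3 ≤ d) (ht : 2 ≤ t)
    (ε : ℝ) (hε : 0 < ε) :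
    ∃ C : ℝ, 0 < C ∧
      ∀ (Q : Finset (Fin d → ℝ)) (H : Finset (Submodule ℝ (Fin d → ℝ))) (m n : ℕ),
        Q.card = n → H.card = m →
        (∀ q ∈ Q, q ≠ 0) →
        (∀ q ∈ Q, ∀ q' ∈ Q, q ≠ q' → ∀ c : ℝ, q ≠ c • q') →
        (∀ h ∈ H, Module.finrank ℝ h = d - 1) →
        (¬ ∃ q ∈ Q, ∃ q' ∈ Q, q ≠ q' ∧
            ∃ T : Finset (Submodule ℝ (Fin d → ℝ)), T ⊆ H ∧ T.card = t ∧
              ∀ h ∈ T, q ∈ h ∧ q' ∈ h) →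
        (Set.ncard {x : (Fin d → ℝ) × Submodule ℝ (Fin d → ℝ) |
            x.1 ∈ Q ∧ x.2 ∈ H ∧ x.1 ∈ x.2} : ℝ) ≤
          C * ((n : ℝ) ^ ((2 * (d : ℝ) - 4) / (2 * (d : ℝ) - 3) + ε) *
                (m : ℝ) ^ (((d : ℝ) - 1) / (2 * (d : ℝ) - 3)) + (m : ℝ) + (n : ℝ)) := by
  classical
  obtain ⟨D, rfl⟩ : ∃ D, d = D + 1 := ⟨d - 1, by omega⟩
  have hD : 2 ≤ D := by omega
  have hDR : (2 : ℝ) ≤ D := by exact_mod_cast hD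
  have hden : (0 : ℝ) < 2 * D - 1 := by linarith
  have hexp₁ : (2 * ((D + 1 : ℕ) : ℝ) - 4) / (2 * ((D + 1 : ℕ) : ℝ) - 3) =
      1 - 1 / (2 * D - 1) := by
    push_cast
    rw [show 2 * ((D : ℝ) + 1) - 3 = 2 * D - 1 by ring]
    field_simp
    ring
  have hexp₂ : (((D + 1 : ℕ) : ℝ) - 1) / (2 * ((D + 1 : ℕ) : ℝ) - 3) = D / (2 * D - 1) := by
    push_cast
    rw [show 2 * ((D : ℝ) + 1) - 3 = 2 * D - 1 by ring, add_sub_cancel_right]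
  rw [hexp₁, hexp₂]
  set δ : ℝ := 1 / (2 * D - 1) with hδ
  have hδ0 : 0 < δ := by positivity
  have hδ1 : δ < 1 := by rw [hδ, div_lt_one hden]; linarith
  have hDδ : D / (2 * D - 1) = D * δ := by rw [hδ]; ring
  have hδD : (2 * D - 1) * δ = 1 := by rw [hδ]; field_simp
  rw [hDδ]
  set η : ℝ := min ε δ with hη
  have hη0 : 0 < η := lt_min hε hδ0
  have hηδ : η ≤ δ := min_le_right _ _
  obtain ⟨C, C', hC, hC', hmain⟩ := HyperplaneIncidence.exists_incidences_le
    (V := Fin (D + 1) → ℝ) (D := D) (by simp) hD (t := t) (by omega) (ε := η) (a := 1 - δ + η)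
    (β := D * δ) hη0 (by linarith) (by linarith) (by linarith) (by positivity) (by nlinarith)
    (by ring) (by linarith)
  refine ⟨max C C', lt_max_of_lt_left hC, fun Q H m n hQ hH hQ0 _ hHD hfree => ?_⟩
  have hfew : HyperplaneIncidence.FewCommon t Q H := by
    intro q hq q' hq' hne
    by_contra! hle
    obtain ⟨T, hT, hTcard⟩ := Finset.exists_subset_card_eq hle
    refine hfree ⟨q, hq, q', hq', hne, T, hT.trans (Finset.filter_subset _ _), hTcard,
      fun h hh => (Finset.mem_filter.1 (hT hh)).2⟩
  have hbound := hmain Q H hQ0 hHD hfew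
  rw [HyperplaneIncidence.ncard_incidences_eq]
  rw [hQ, hH] at hbound
  refine hbound.trans ?_
  have hpow : (n : ℝ) ^ (1 - δ + η) ≤ (n : ℝ) ^ (1 - δ + ε) := by
    rcases Nat.eq_zero_or_pos n with rfl | hn
    · rw [Nat.cast_zero, Real.zero_rpow (by linarith), Real.zero_rpow (by linarith)]
    · exact Real.rpow_le_rpow_of_exponent_le (by exact_mod_cast hn)
        (by linarith [min_le_left ε δ])
  calc C * ((n : ℝ) ^ (1 - δ + η) * (m : ℝ) ^ (D * δ)) + C' * (m + n)
      ≤ max C C' * ((n : ℝ) ^ (1 - δ + ε) * (m : ℝ) ^ (D * δ)) + max C C' * (m + n) := by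
        gcongr
        · exact le_max_left _ _
        · exact le_max_right _ _
    _ = _ := by ring
end
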